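/- arXiv:2004.14348 — 7 statements merged into one kernel-verified Lean document; each statement's English description precedes it below -/
import Mathlib

section
/- For every r > 0 and every n ∈ ℤ∖{0}, the linear operator 𝒥_n(r) : 𝓗 → 𝓗 is injective if and only if L_j^{(|n|)}(|n|·r²) ≠ 0 for every j ∈ ℕ. -/
noncomputable section

open Complex MeasureTheory Real Set

/-- The Bargmann–Fock representation for `h > 0`, acting pointwise. -/
def betaP (h : ℝ) (z : ℂ) (t : ℝ) (F : ℂ → ℂ) (ζ : ℂ) : ℂ :=
  Complex.exp (2 * Complex.I * (h : ℂ) * (t : ℂ) - ((Real.sqrt h : ℝ) : ℂ) * ζ * (starRingEnd ℂ) z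
      - ((h : ℂ) / 2) * ((Complex.normSq z : ℝ) : ℂ)) * F (ζ + ((Real.sqrt h : ℝ) : ℂ) * z)

/-- The Bargmann–Fock representation `β_h(z,t)` for `h ≠ 0`:
for `h < 0` it is `β_{|h|}(conj z, −t)`. -/
def beta (h : ℝ) (z : ℂ) (t : ℝ) (F : ℂ → ℂ) (ζ : ℂ) : ℂ :=
  if 0 < h then betaP h z t F ζ else betaP |h| ((starRingEnd ℂ) z) (-t) F ζ

/-- The adjoint `β_h(z,t)* = β_h((z,t)⁻¹) = β_h(−z,−t)`. -/
def betaStar (h : ℝ) (p : ℂ × ℝ) (F : ℂ → ℂ) (ζ : ℂ) : ℂ :=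
  beta h (-p.1) (-p.2) F ζ

/-- Membership in Bargmann–Fock space `𝓗`: entire with
`(1/π) ∫_ℂ |F(ζ)|² e^{−|ζ|²} dζ < ∞`. -/
def InFock (F : ℂ → ℂ) : Prop :=
  Differentiable ℂ F ∧
    Integrable (fun ζ : ℂ => ‖F ζ‖ ^ 2 * Real.exp (-Complex.normSq ζ))

/-- The group Fourier transform `𝓕_ℍ f(h)`, acting pointwise on `F ∈ 𝓗`:
`(𝓕_ℍ f(h) F)(ζ) = ∫_{ℂ×ℝ} f(z,t) (β_h(z,t)* F)(ζ) dz dt`. -/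
def fourierH (f : ℂ × ℝ → ℂ) (h : ℝ) (F : ℂ → ℂ) (ζ : ℂ) : ℂ :=
  ∫ p : ℂ × ℝ, f p * betaStar h p F ζ

/-- The multiplier operator `𝒥_n(r)`:
`(𝒥_n(r) F)(ζ) = (1/2π) ∫₀^{2π} (β_n(r e^{iθ}, θ/2) F)(ζ) dθ`. -/
def Jop (n : ℤ) (r : ℝ) (F : ℂ → ℂ) (ζ : ℂ) : ℂ :=
  ((1 / (2 * π) : ℝ) : ℂ) *
    ∫ θ in (0 : ℝ)..(2 * π), beta (n : ℝ) (((r : ℝ) : ℂ) * Complex.exp (Complex.I * (θ : ℂ))) (θ / 2) F ζ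

/-- Generalized Laguerre polynomials `L_j^{(α)}(x)`, defined by the recurrence
`L_0^{(α)} = 1`, `L_1^{(α)}(x) = 1 + α − x`,
`(j+1) L_{j+1}^{(α)}(x) = (2j+1+α−x) L_j^{(α)}(x) − (j+α) L_{j−1}^{(α)}(x)`. -/
def lag (α : ℝ) : ℕ → ℝ → ℝ
  | 0 => fun _ => 1
  | 1 => fun x => 1 + α - x
  | (j + 2) => fun x =>
      ((2 * ((j : ℝ) + 1) + 1 + α - x) * lag α (j + 1) x - (((j : ℝ) + 1) + α) * lag α j x)
        / ((j : ℝ) + 2)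

open scoped Nat

/-- The sum representing `p! / (p + N)! * L_p^{(N)}(x)`. -/
def lagSum (N p : ℕ) (x : ℝ) : ℝ :=
  ∑ m ∈ Finset.range (p + 1), (p.choose m : ℝ) * (-x) ^ m / (m + N)!

lemma lagSum_eq_of_le (N : ℕ) {p M : ℕ} (h : p + 1 ≤ M) (x : ℝ) :
    lagSum N p x = ∑ m ∈ Finset.range M, (p.choose m : ℝ) * (-x) ^ m / (m + N)! := by
  refine Finset.sum_subset (Finset.range_subset_range.mpr h) fun m _ hm => ?_
  rw [Nat.choose_eq_zero_of_lt (by rw [Finset.mem_range] at hm; omega)]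
  simp

lemma choose_three_term (N p m : ℕ) :
    ((p : ℝ) + 2 + N) * (p + 2).choose (m + 1) =
      (2 * p + 3 + N) * (p + 1).choose (m + 1) + (m + 1 + N) * (p + 1).choose m
        - (p + 1) * p.choose (m + 1) := by
  have h1 : ((p + 2).choose (m + 1) : ℝ) = (p + 1).choose m + (p + 1).choose (m + 1) := by
    exact_mod_cast Nat.choose_succ_succ (p + 1) m
  have h2 : ((p + 1).choose (m + 1) : ℝ) = p.choose m + p.choose (m + 1) := by
    exact_mod_cast Nat.choose_succ_succ p m
  have h3 : ((p : ℝ) + 1) * p.choose m = (p + 1).choose m * (p + 1 - m) := by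
    rcases le_or_gt m (p + 1) with hm | hm
    · have h4 : (p.choose m : ℝ) * (p + 1) = (p + 1).choose m * ((p + 1 - m : ℕ) : ℝ) := by
        exact_mod_cast Nat.choose_mul_succ_eq p m
      rw [Nat.cast_sub hm] at h4
      push_cast at h4
      linarith
    · rw [Nat.choose_eq_zero_of_lt hm, Nat.choose_eq_zero_of_lt (by omega)]
      simp
  rw [h1]
  linear_combination (-(p : ℝ) - 1) * h2 - h3

lemma lagSum_three_term (N p : ℕ) (x : ℝ) :
    ((p : ℝ) + 2 + N) * lagSum N (p + 2) x =
      (2 * p + 3 + N - x) * lagSum N (p + 1) x - (p + 1) * lagSum N p x := by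
  have hx : x * lagSum N (p + 1) x = -∑ m ∈ Finset.range (p + 2),
      (m + 1 + N) * ((p + 1).choose m : ℝ) * (-x) ^ (m + 1) / (m + 1 + N)! := by
    rw [lagSum, Finset.mul_sum, ← Finset.sum_neg_distrib]
    refine Finset.sum_congr rfl fun m _ => ?_
    have : (m + 1 + N)! = (m + N + 1) * (m + N)! := by
      rw [show m + 1 + N = m + N + 1 by ring, Nat.factorial_succ]
    rw [this]
    have h0 : ((m + N)! : ℝ) ≠ 0 := by positivity
    have h1 : ((m : ℝ) + N + 1) ≠ 0 := by positivity
    push_cast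
    field_simp
    ring
  rw [sub_mul, hx, lagSum_eq_of_le N (M := p + 2 + 1) (by omega) x,
    lagSum_eq_of_le N (p := p + 1) (M := p + 2 + 1) (by omega) x,
    lagSum_eq_of_le N (p := p) (M := p + 2 + 1) (by omega) x,
    Finset.sum_range_succ', Finset.sum_range_succ' _ (p + 2), Finset.sum_range_succ' _ (p + 2)]
  simp only [mul_add, Finset.mul_sum]
  have key : ∑ m ∈ Finset.range (p + 2), ((p : ℝ) + 2 + N) *
        (((p + 2).choose (m + 1) : ℝ) * (-x) ^ (m + 1) / (m + 1 + N)!) =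
      ∑ m ∈ Finset.range (p + 2), (2 * (p : ℝ) + 3 + N) *
        (((p + 1).choose (m + 1) : ℝ) * (-x) ^ (m + 1) / (m + 1 + N)!) +
      ∑ m ∈ Finset.range (p + 2),
        ((m : ℝ) + 1 + N) * ((p + 1).choose m : ℝ) * (-x) ^ (m + 1) / (m + 1 + N)! -
      ∑ m ∈ Finset.range (p + 2), ((p : ℝ) + 1) *
        ((p.choose (m + 1) : ℝ) * (-x) ^ (m + 1) / (m + 1 + N)!) := by
    rw [← Finset.sum_add_distrib, ← Finset.sum_sub_distrib]
    refine Finset.sum_congr rfl fun m _ => ?_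
    linear_combination ((-x) ^ (m + 1) / (m + 1 + N)!) * choose_three_term N p m
  rw [key]
  simp only [Nat.choose_zero_right]
  ring

lemma factorial_mul_lagSum (N : ℕ) (x : ℝ) :
    ∀ p : ℕ, ((p + N)! : ℝ) * lagSum N p x = p ! * lag N p x
  | 0 => by
    have : (N ! : ℝ) ≠ 0 := by positivity
    simp [lagSum, lag, this]
  | 1 => by
    have h0 : (N ! : ℝ) ≠ 0 := by positivity
    have h1 : (N : ℝ) + 1 ≠ 0 := by positivity
    simp only [lagSum, lag, Finset.sum_range_succ, Finset.sum_range_zero, add_comm 1 N,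
      Nat.factorial_succ, zero_add]
    simp
    field_simp
    ring
  | p + 2 => by
    have ih1 := factorial_mul_lagSum N x (p + 1)
    have ih0 := factorial_mul_lagSum N x p
    have h := lagSum_three_term N p x
    have e1 : (p + 2 + N)! = (p + N + 2) * ((p + N + 1) * (p + N)!) := by
      rw [show p + 2 + N = p + N + 1 + 1 by ring, Nat.factorial_succ, Nat.factorial_succ]
    have e2 : (p + 1 + N)! = (p + N + 1) * (p + N)! := by
      rw [show p + 1 + N = p + N + 1 by ring, Nat.factorial_succ]
    have e3 : (p + 2)! = (p + 2) * ((p + 1) * p !) := by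
      rw [Nat.factorial_succ, Nat.factorial_succ]
    have e4 : (p + 1)! = (p + 1) * p ! := Nat.factorial_succ p
    rw [e2, e4] at ih1
    rw [e1, e3]
    simp only [lag]
    have h2 : (p : ℝ) + 2 ≠ 0 := by positivity
    push_cast at ih1 ⊢
    field_simp
    linear_combination ((p : ℝ) + N + 1) * (p + N)! * h +
      (2 * (p : ℝ) + 3 + N - x) * ih1 - ((p : ℝ) + 1) * (p + N + 1) * ih0

lemma lagSum_ne_zero_iff (N p : ℕ) (x : ℝ) : lagSum N p x ≠ 0 ↔ lag N p x ≠ 0 := by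
  have h := factorial_mul_lagSum N x p
  have h1 : ((p + N)! : ℝ) ≠ 0 := by positivity
  have h2 : (p ! : ℝ) ≠ 0 := by positivity
  rw [← mul_ne_zero_iff_left (a := ((p + N)! : ℝ)) h1, h, mul_ne_zero_iff_left h2]

lemma integral_exp_int_mul_I (k : ℤ) :
    ∫ θ in (0 : ℝ)..(2 * π), Complex.exp (k * Complex.I * θ) = if k = 0 then 2 * (π : ℂ) else 0 := by
  split_ifs with hk
  · simp [hk]
  · have hc : (k : ℂ) * Complex.I ≠ 0 := by simp [hk]
    rw [integral_exp_mul_complex hc]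
    have : Complex.exp (k * Complex.I * ((2 * π : ℝ) : ℂ)) = 1 := by
      rw [← Complex.exp_int_mul_two_pi_mul_I k]
      push_cast
      ring_nf
    rw [this]
    simp

/-- The Fourier coefficients of `θ ↦ exp (x e^{iθ})`. -/
lemma integral_exp_neg_mul_exp_exp (k : ℕ) (x : ℂ) :
    ∫ θ in (0 : ℝ)..(2 * π), Complex.exp (-(k * Complex.I * θ)) *
      Complex.exp (x * Complex.exp (Complex.I * θ)) = 2 * π * (x ^ k / k !) := by
  have hs : HasSum (fun m : ℕ => ∫ θ in (0 : ℝ)..(2 * π), Complex.exp (-(k * Complex.I * θ)) *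
      ((x * Complex.exp (Complex.I * θ)) ^ m / m !))
      (∫ θ in (0 : ℝ)..(2 * π), Complex.exp (-(k * Complex.I * θ)) *
        Complex.exp (x * Complex.exp (Complex.I * θ))) := by
    refine intervalIntegral.hasSum_integral_of_dominated_convergence
      (fun m _ => ‖x‖ ^ m / m !) (fun m => ?_) (fun m => ?_) ?_ ?_ ?_
    · exact (by fun_prop : Continuous _).aestronglyMeasurable
    · refine .of_forall fun θ _ => le_of_eq ?_
      simp [Complex.norm_exp]
    · exact .of_forall fun θ _ => Real.summable_pow_div_factorial _
    · simp
    · refine .of_forall fun θ _ => HasSum.mul_left _ ?_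
      rw [Complex.exp_eq_exp_ℂ]
      exact NormedSpace.expSeries_div_hasSum_exp _
  refine hs.unique ?_
  have hterm : ∀ m : ℕ, ∫ θ in (0 : ℝ)..(2 * π), Complex.exp (-(k * Complex.I * θ)) *
      ((x * Complex.exp (Complex.I * θ)) ^ m / m !) =
      if m = k then 2 * π * (x ^ k / k !) else 0 := by
    intro m
    have : ∀ θ : ℝ, Complex.exp (-(k * Complex.I * θ)) *
        ((x * Complex.exp (Complex.I * θ)) ^ m / m !) =
        x ^ m / m ! * Complex.exp (((m - k : ℤ) : ℂ) * Complex.I * θ) := by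
      intro θ
      rw [show ((m - k : ℤ) : ℂ) * Complex.I * θ =
        -(k * Complex.I * θ) + m * (Complex.I * θ) by push_cast; ring, Complex.exp_add,
        Complex.exp_nat_mul]
      ring
    simp_rw [this]
    rw [intervalIntegral.integral_const_mul, integral_exp_int_mul_I]
    by_cases h : m = k
    · simp [h, mul_comm]
    · have : (m : ℤ) - k ≠ 0 := by omega
      simp [h, this]
  simp_rw [hterm]
  exact hasSum_ite_eq k _

/-- The integrand of `𝒥_n(r)` in the reflected angular variable, with `a = √|n| r`. -/
def reflectedIntegrand (N : ℕ) (a : ℝ) (F : ℂ → ℂ) (ζ : ℂ) (θ : ℝ) : ℂ :=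
  Complex.exp (-(N * Complex.I * θ)) * Complex.exp (-(a * ζ) * Complex.exp (Complex.I * θ)) *
    F (ζ + a * Complex.exp (-(Complex.I * θ)))

lemma Jop_eq_of_neg {n : ℤ} (hn : n < 0) (r : ℝ) (F : ℂ → ℂ) (ζ : ℂ) :
    Jop n r F ζ = ((1 / (2 * π) : ℝ) : ℂ) * (Complex.exp (-(n.natAbs / 2 * r ^ 2)) *
      ∫ θ in (0 : ℝ)..(2 * π), reflectedIntegrand n.natAbs (√n.natAbs * r) F ζ θ) := by
  have hn' : ¬ (0 : ℝ) < n := by exact_mod_cast hn.le.not_gt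
  have habs : |(n : ℝ)| = n.natAbs := by simp [Nat.cast_natAbs]
  rw [Jop]
  congr 1
  rw [← intervalIntegral.integral_const_mul]
  refine intervalIntegral.integral_congr fun θ _ => ?_
  simp only [beta, if_neg hn', betaP, habs, reflectedIntegrand]
  have hconj : (starRingEnd ℂ) ((r : ℂ) * Complex.exp (Complex.I * θ)) =
      r * Complex.exp (-(Complex.I * θ)) := by
    rw [map_mul, ← Complex.exp_conj]; simp
  have hnorm : Complex.normSq ((starRingEnd ℂ) ((r : ℂ) * Complex.exp (Complex.I * θ))) = r ^ 2 := by
    rw [Complex.normSq_eq_norm_sq]; simp [Complex.norm_exp]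
  rw [hnorm, Complex.conj_conj, hconj, ← Complex.exp_add,
    ← mul_assoc (Complex.exp (-(n.natAbs / 2 * r ^ 2))), ← Complex.exp_add]
  push_cast
  congr 2 <;> ring

lemma Jop_eq_of_pos {n : ℤ} (hn : 0 < n) (r : ℝ) (F : ℂ → ℂ) (ζ : ℂ) :
    Jop n r F ζ = ((1 / (2 * π) : ℝ) : ℂ) * (Complex.exp (-(n.natAbs / 2 * r ^ 2)) *
      ∫ θ in (0 : ℝ)..(2 * π), reflectedIntegrand n.natAbs (√n.natAbs * r) F ζ θ) := by
  have hn' : (0 : ℝ) < n := by exact_mod_cast hn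
  have habs : (n : ℝ) = n.natAbs := by simp [Nat.cast_natAbs, abs_of_pos hn]
  have hrefl := intervalIntegral.integral_comp_sub_left
    (fun θ => reflectedIntegrand n.natAbs (√n.natAbs * r) F ζ θ) (a := 0) (b := 2 * π) (2 * π)
  simp only [sub_self, sub_zero] at hrefl
  rw [Jop, ← hrefl]
  congr 1
  rw [← intervalIntegral.integral_const_mul]
  refine intervalIntegral.integral_congr fun θ _ => ?_
  simp only [beta, if_pos hn']
  simp only [betaP, habs, reflectedIntegrand]
  have hconj : (starRingEnd ℂ) ((r : ℂ) * Complex.exp (Complex.I * θ)) =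
      r * Complex.exp (-(Complex.I * θ)) := by
    rw [map_mul, ← Complex.exp_conj]; simp
  have hnorm : Complex.normSq ((r : ℂ) * Complex.exp (Complex.I * θ)) = r ^ 2 := by
    rw [Complex.normSq_eq_norm_sq]; simp [Complex.norm_exp]
  have e1 : Complex.exp (Complex.I * ((2 * π - θ : ℝ) : ℂ)) = Complex.exp (-(Complex.I * θ)) := by
    rw [Complex.exp_eq_exp_iff_exists_int]
    exact ⟨1, by push_cast; ring⟩
  have e2 : Complex.exp (-(Complex.I * ((2 * π - θ : ℝ) : ℂ))) = Complex.exp (Complex.I * θ) := by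
    rw [Complex.exp_eq_exp_iff_exists_int]
    exact ⟨-1, by push_cast; ring⟩
  have e3 : Complex.exp (-(n.natAbs * Complex.I * ((2 * π - θ : ℝ) : ℂ))) =
      Complex.exp (n.natAbs * Complex.I * θ) := by
    rw [Complex.exp_eq_exp_iff_exists_int]
    exact ⟨-(n.natAbs : ℤ), by rw [Int.cast_neg, Int.cast_natCast]; push_cast; ring⟩
  rw [hnorm, hconj, e1, e2, e3, ← Complex.exp_add,
    ← mul_assoc (Complex.exp (-(n.natAbs / 2 * r ^ 2))), ← Complex.exp_add]
  push_cast
  congr 2 <;> ring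

lemma Jop_eq {n : ℤ} (hn : n ≠ 0) (r : ℝ) (F : ℂ → ℂ) (ζ : ℂ) :
    Jop n r F ζ = ((1 / (2 * π) : ℝ) : ℂ) * (Complex.exp (-(n.natAbs / 2 * r ^ 2)) *
      ∫ θ in (0 : ℝ)..(2 * π), reflectedIntegrand n.natAbs (√n.natAbs * r) F ζ θ) :=
  hn.lt_or_gt.elim (fun h => Jop_eq_of_neg h r F ζ) (fun h => Jop_eq_of_pos h r F ζ)

lemma integral_reflectedIntegrand_pow (N : ℕ) (a : ℝ) (p : ℕ) (ζ : ℂ) :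
    ∫ θ in (0 : ℝ)..(2 * π), reflectedIntegrand N a (fun w => w ^ p) ζ θ =
      2 * π * ((-a) ^ N * lagSum N p (a ^ 2)) * ζ ^ (p + N) := by
  have hexp : ∀ θ : ℝ, reflectedIntegrand N a (fun w => w ^ p) ζ θ =
      ∑ m ∈ Finset.range (p + 1), (a ^ m * ζ ^ (p - m) * p.choose m) *
        (Complex.exp (-((m + N : ℕ) * Complex.I * θ)) *
          Complex.exp (-(a * ζ) * Complex.exp (Complex.I * θ))) := by
    intro θ
    rw [reflectedIntegrand, add_comm ζ, add_pow, Finset.mul_sum]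
    refine Finset.sum_congr rfl fun m _ => ?_
    rw [show -(((m + N : ℕ) : ℂ) * Complex.I * θ) = -(N * Complex.I * θ) + m * -(Complex.I * θ) by
      push_cast; ring, Complex.exp_add, Complex.exp_nat_mul]
    ring
  simp_rw [hexp]
  rw [intervalIntegral.integral_finsetSum
    fun m _ => (by fun_prop : Continuous _).intervalIntegrable _ _]
  simp_rw [intervalIntegral.integral_const_mul, integral_exp_neg_mul_exp_exp]
  rw [lagSum]
  push_cast
  simp only [Finset.mul_sum, Finset.sum_mul]
  refine Finset.sum_congr rfl fun m hm => ?_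
  have hmp : m ≤ p := Nat.lt_succ_iff.mp (Finset.mem_range.mp hm)
  obtain ⟨q, rfl⟩ := Nat.exists_eq_add_of_le hmp
  rw [Nat.add_sub_cancel_left, neg_mul_eq_neg_mul, mul_pow,
    show (-((a : ℂ) ^ 2)) ^ m = a ^ m * (-a) ^ m by rw [← mul_pow]; ring]
  ring

lemma hasSum_integral_reflectedIntegrand (N : ℕ) (a : ℝ) {F : ℂ → ℂ} {b : ℕ → ℂ}
    (hF : ∀ z, HasSum (fun p => b p * z ^ p) (F z)) (ζ : ℂ) :
    HasSum (fun p => b p * (2 * π * ((-a) ^ N * lagSum N p (a ^ 2)) * ζ ^ (p + N)))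
      (∫ θ in (0 : ℝ)..(2 * π), reflectedIntegrand N a F ζ θ) := by
  simp_rw [← integral_reflectedIntegrand_pow, ← intervalIntegral.integral_const_mul]
  refine intervalIntegral.hasSum_integral_of_dominated_convergence
    (fun p _ => Real.exp (‖(a : ℂ) * ζ‖) * ‖b p * ((‖ζ‖ + |a| : ℝ) : ℂ) ^ p‖)
    (fun p => ?_) (fun p => ?_) ?_ ?_ ?_
  · unfold reflectedIntegrand
    exact (by fun_prop : Continuous _).aestronglyMeasurable
  · refine .of_forall fun θ _ => ?_
    have h1 : ‖Complex.exp (-(a * ζ) * Complex.exp (Complex.I * θ))‖ ≤ Real.exp ‖(a : ℂ) * ζ‖ := by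
      refine (Complex.norm_exp_le_exp_norm _).trans (Real.exp_le_exp.mpr ?_)
      simp [Complex.norm_exp]
    have h2 : ‖ζ + a * Complex.exp (-(Complex.I * θ))‖ ≤ ‖ζ‖ + |a| := by
      refine (norm_add_le _ _).trans_eq ?_
      simp [Complex.norm_exp]
    have h3 : ‖Complex.exp (-(N * Complex.I * θ))‖ = 1 := by simp [Complex.norm_exp]
    have h4 : ‖((‖ζ‖ + |a| : ℝ) : ℂ)‖ = ‖ζ‖ + |a| := by
      rw [Complex.norm_real, Real.norm_of_nonneg (by positivity)]
    rw [reflectedIntegrand, norm_mul, norm_mul, norm_mul, norm_mul (b p), norm_pow, norm_pow, h3,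
      h4, one_mul, mul_left_comm]
    gcongr
  · exact .of_forall fun θ _ => (hF _).summable.norm.mul_left _
  · simp
  · refine .of_forall fun θ _ => ?_
    have := (hF (ζ + a * Complex.exp (-(Complex.I * θ)))).mul_left
      (Complex.exp (-(N * Complex.I * θ)) * Complex.exp (-(a * ζ) * Complex.exp (Complex.I * θ)))
    refine this.congr_fun fun p => ?_
    simp only [reflectedIntegrand]
    ring

/-- The scalar by which `𝒥_n(r)` maps `ζ ^ p` to a multiple of `ζ ^ (p + |n|)`. -/
def JopMultiplier (n : ℤ) (r : ℝ) (p : ℕ) : ℂ :=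
  Complex.exp (-(n.natAbs / 2 * r ^ 2)) *
    ((-(√n.natAbs * r : ℝ)) ^ n.natAbs * lagSum n.natAbs p (n.natAbs * r ^ 2))

lemma JopMultiplier_ne_zero_iff {n : ℤ} (hn : n ≠ 0) {r : ℝ} (hr : 0 < r) (p : ℕ) :
    JopMultiplier n r p ≠ 0 ↔ lag n.natAbs p (n.natAbs * r ^ 2) ≠ 0 := by
  have hN : (0 : ℝ) < n.natAbs := by exact_mod_cast Int.natAbs_pos.mpr hn
  have ha : (((√n.natAbs * r : ℝ)) : ℂ) ≠ 0 := by
    exact_mod_cast (mul_pos (Real.sqrt_pos.mpr hN) hr).ne'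
  rw [← lagSum_ne_zero_iff, JopMultiplier, mul_ne_zero_iff_left (Complex.exp_ne_zero _),
    mul_ne_zero_iff_left (pow_ne_zero _ (neg_ne_zero.mpr ha))]
  exact_mod_cast Iff.rfl

lemma hasSum_Jop {n : ℤ} (hn : n ≠ 0) (r : ℝ) {F : ℂ → ℂ} {b : ℕ → ℂ}
    (hF : ∀ z, HasSum (fun p => b p * z ^ p) (F z)) (ζ : ℂ) :
    HasSum (fun p => b p * JopMultiplier n r p * ζ ^ (p + n.natAbs)) (Jop n r F ζ) := by
  rw [Jop_eq hn]
  refine (((hasSum_integral_reflectedIntegrand n.natAbs (√n.natAbs * r) hF ζ).mul_left _).mul_left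
    _).congr_fun fun p => ?_
  have hsq : (√n.natAbs * r) ^ 2 = n.natAbs * r ^ 2 := by
    rw [mul_pow, Real.sq_sqrt (Nat.cast_nonneg _)]
  have hpi : (π : ℂ) ≠ 0 := by exact_mod_cast Real.pi_ne_zero
  rw [JopMultiplier, hsq]
  push_cast
  field_simp

lemma exists_hasSum_of_entire {F : ℂ → ℂ} (hF : Differentiable ℂ F) :
    ∃ b : ℕ → ℂ, ∀ z, HasSum (fun p => b p * z ^ p) (F z) :=
  ⟨fun p => (p ! : ℂ)⁻¹ * iteratedDeriv p F 0, fun z =>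
    (Complex.hasSum_taylorSeries_of_entire hF 0 z).congr_fun fun p => by
      simp only [sub_zero, smul_eq_mul]; ring⟩

lemma coeff_unique {f : ℂ → ℂ} {b c : ℕ → ℂ} (N : ℕ)
    (hb : ∀ z, HasSum (fun p => b p * z ^ (p + N)) (f z))
    (hc : ∀ z, HasSum (fun p => c p * z ^ (p + N)) (f z)) : b = c := by
  have aux : ∀ d : ℕ → ℂ, (∀ z, HasSum (fun p => d p * z ^ (p + N)) (f z)) →
      HasFPowerSeriesAt f (FormalMultilinearSeries.ofScalars ℂ
        fun q => if q < N then 0 else d (q - N)) 0 := by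
    intro d hd
    rw [hasFPowerSeriesAt_iff]
    refine .of_forall fun z => ?_
    rw [zero_add, ← hasSum_nat_add_iff' N]
    simp only [FormalMultilinearSeries.coeff_ofScalars]
    rw [Finset.sum_eq_zero (fun i hi => by simp [Finset.mem_range.mp hi]), sub_zero]
    refine (hd z).congr_fun fun p => ?_
    simp [mul_comm]
  have h := (aux b hb).eq_formalMultilinearSeries (aux c hc)
  funext p
  have := congrArg (fun s => s.coeff (p + N)) h
  simpa [FormalMultilinearSeries.coeff_ofScalars] using this

lemma inFock_pow (j : ℕ) : InFock fun ζ => ζ ^ j := by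
  refine ⟨by fun_prop, .of_integral_ne_zero ?_⟩
  have h := Complex.integral_rpow_mul_exp_neg_rpow (p := 2) (q := (2 * j : ℕ)) (by norm_num)
    (by have : (0 : ℝ) ≤ (2 * j : ℕ) := by positivity
        linarith)
  have he : ∀ ζ : ℂ, ‖ζ ^ j‖ ^ 2 * Real.exp (-Complex.normSq ζ) =
      ‖ζ‖ ^ (((2 * j : ℕ) : ℝ)) * Real.exp (-‖ζ‖ ^ (2 : ℝ)) := by
    intro ζ
    rw [Real.rpow_natCast, Real.rpow_two, Complex.normSq_eq_norm_sq, norm_pow, ← pow_mul, mul_comm j]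
  simp_rw [he]
  rw [h]
  positivity

lemma inFock_zero : InFock fun _ => 0 := by
  refine ⟨by fun_prop, ?_⟩
  simp

/-- `𝒥_n(r) : 𝓗 → 𝓗` is injective iff `L_j^{(|n|)}(|n| r²) ≠ 0` for every `j ∈ ℕ`. -/
theorem Jop_injective_iff (r : ℝ) (hr : 0 < r) (n : ℤ) (hn : n ≠ 0) :
    (∀ F G : ℂ → ℂ, InFock F → InFock G →
        (∀ ζ : ℂ, Jop n r F ζ = Jop n r G ζ) → F = G) ↔
      ∀ j : ℕ, lag ((n.natAbs : ℕ) : ℝ) j (((n.natAbs : ℕ) : ℝ) * r ^ 2) ≠ 0 := by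
  simp_rw [← JopMultiplier_ne_zero_iff hn hr]
  constructor
  · intro hinj j hj
    have hpow : ∀ z : ℂ, HasSum (fun p => (if p = j then 1 else 0) * z ^ p) (z ^ j) := fun z => by
      refine (hasSum_ite_eq j (z ^ j)).congr_fun fun p => ?_
      split_ifs with h <;> simp [h]
    have hzero : ∀ z : ℂ, HasSum (fun p => (0 : ℂ) * z ^ p) 0 := fun z => by
      simp
    have h := hinj _ _ (inFock_pow j) inFock_zero fun ζ => by
      refine (hasSum_Jop hn r hpow ζ).unique
        ((hasSum_Jop hn r (F := fun _ => 0) (b := fun _ => 0) hzero ζ).congr_fun fun p => ?_)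
      rcases eq_or_ne p j with rfl | hp
      · simp [hj]
      · simp [hp]
    simpa using congrFun h 1
  · intro hne F G hF hG hJ
    obtain ⟨b, hb⟩ := exists_hasSum_of_entire hF.1
    obtain ⟨c, hc⟩ := exists_hasSum_of_entire hG.1
    have h := coeff_unique n.natAbs (hasSum_Jop hn r hb)
      (fun ζ => hJ ζ ▸ hasSum_Jop hn r hc ζ)
    have hbc : b = c := funext fun p => mul_right_cancel₀ (hne p) (congrFun h p)
    funext z
    exact (hb z).unique (hbc ▸ hc z)

end
end

section
/- For every odd integer n, the operator 𝒥_n : 𝓗 → 𝓗 is injective. -/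
noncomputable section

open Complex MeasureTheory Real Set

/-- Up to a nonzero factor independent of `m`, the operator `𝒥_N` maps `ζ ^ m` to
`laguerreCoeff N m * ζ ^ (m + N)`; the coefficient is a multiple of the Laguerre value
`L_m^{(N)}(N)`. -/
def laguerreCoeff (N m : ℕ) : ℂ :=
  ∑ j ∈ Finset.range (m + 1), (m.choose j : ℂ) * (-(N : ℂ)) ^ j / ((N + j).factorial : ℂ)

lemma even_choose_mul_ascFactorial {N m j : ℕ} (hN : Odd N) (hj : j < m) :
    Even (m.choose j * (N + j + 1).ascFactorial (m - j)) := by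
  obtain ⟨k, rfl⟩ : ∃ k, m = j + k + 1 := ⟨m - j - 1, by omega⟩
  have hk : j + k + 1 - j = k + 1 := by omega
  rw [hk]
  rcases Nat.eq_zero_or_pos k with rfl | hpos
  · simp only [add_zero, zero_add, Nat.choose_succ_self_right, Nat.ascFactorial_succ,
      Nat.ascFactorial_zero, mul_one]
    rw [Nat.even_mul]
    grind
  · refine Even.mul_left (even_iff_two_dvd.2 ?_) _
    exact (Nat.dvd_factorial (by norm_num) (by omega)).trans (Nat.factorial_dvd_ascFactorial _ _)

lemma odd_sum_choose_mul_ascFactorial {N : ℕ} (hN : Odd N) (m : ℕ) :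
    Odd (∑ j ∈ Finset.range (m + 1),
      ((m.choose j * (N + j + 1).ascFactorial (m - j) : ℕ) : ℤ) * (-(N : ℤ)) ^ j) := by
  rw [Finset.sum_range_succ]
  refine Even.add_odd (Finset.even_sum _ fun j hj => Even.mul_right ?_ _) ?_
  · exact_mod_cast even_choose_mul_ascFactorial hN (Finset.mem_range.1 hj)
  · have : Odd (-(N : ℤ)) := by simpa using hN
    simpa using this.pow

lemma laguerreCoeff_ne_zero {N : ℕ} (hN : Odd N) (m : ℕ) : laguerreCoeff N m ≠ 0 := by
  intro h
  have key : ((m + N).factorial : ℂ) * laguerreCoeff N m =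
      ((∑ j ∈ Finset.range (m + 1),
        ((m.choose j * (N + j + 1).ascFactorial (m - j) : ℕ) : ℤ) * (-(N : ℤ)) ^ j : ℤ) : ℂ) := by
    rw [laguerreCoeff, Finset.mul_sum]
    push_cast
    refine Finset.sum_congr rfl fun j hj => ?_
    have hj' : j ≤ m := Nat.lt_succ_iff.1 (Finset.mem_range.1 hj)
    have hf := Nat.factorial_mul_ascFactorial (N + j) (m - j)
    rw [show N + j + (m - j) = m + N by omega] at hf
    rw [← hf]
    have : ((N + j).factorial : ℂ) ≠ 0 := by exact_mod_cast (N + j).factorial_ne_zero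
    push_cast
    field_simp
  rw [h, mul_zero] at key
  have h0 := odd_sum_choose_mul_ascFactorial hN m
  rw [Int.cast_eq_zero.1 key.symm] at h0
  simp at h0

lemma integral_exp_int_mul (k : ℤ) :
    ∫ θ in (0 : ℝ)..(2 * π), Complex.exp (Complex.I * θ) ^ k = if k = 0 then 2 * (π : ℂ) else 0 := by
  split_ifs with hk
  · simp [hk]
  · have hc : (k : ℂ) * Complex.I ≠ 0 := by simp [hk]
    have : ∀ θ : ℝ, Complex.exp (Complex.I * θ) ^ k = Complex.exp ((k * Complex.I) * θ) := by
      intro θ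
      rw [← Complex.exp_int_mul]
      ring_nf
    simp_rw [this]
    rw [integral_exp_mul_complex hc]
    have : Complex.exp ((k * Complex.I) * ((2 * π : ℝ) : ℂ)) = 1 := by
      rw [← Complex.exp_int_mul_two_pi_mul_I k]
      push_cast
      ring_nf
    rw [this]
    simp

lemma integral_pow_mul_exp_inv (p : ℕ) (c : ℂ) :
    ∫ θ in (0 : ℝ)..(2 * π),
      Complex.exp (Complex.I * θ) ^ p * Complex.exp (c * (Complex.exp (Complex.I * θ))⁻¹) =
      2 * π * (c ^ p / (p.factorial : ℂ)) := by
  have hterm : ∀ (k : ℕ) (θ : ℝ), c ^ k / (k.factorial : ℂ) *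
      Complex.exp (Complex.I * θ) ^ ((p : ℤ) - k) = Complex.exp (Complex.I * θ) ^ p *
      ((c * (Complex.exp (Complex.I * θ))⁻¹) ^ k / (k.factorial : ℂ)) := by
    intro k θ
    rw [zpow_sub₀ (Complex.exp_ne_zero _)]
    simp only [zpow_natCast, mul_pow, inv_pow]
    ring
  have hnorm : ∀ θ : ℝ, ‖Complex.exp (Complex.I * θ)‖ = 1 := fun θ => by
    rw [mul_comm]; exact Complex.norm_exp_ofReal_mul_I θ
  have hs := intervalIntegral.hasSum_integral_of_dominated_convergence (a := 0) (b := 2 * π)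
    (μ := volume)
    (F := fun (k : ℕ) (θ : ℝ) => c ^ k / (k.factorial : ℂ) *
      Complex.exp (Complex.I * θ) ^ ((p : ℤ) - k))
    (f := fun θ : ℝ => Complex.exp (Complex.I * θ) ^ p *
      Complex.exp (c * (Complex.exp (Complex.I * θ))⁻¹))
    (fun k _ => ‖c‖ ^ k / (k.factorial : ℝ))
    (fun k => by
      simp_rw [hterm]
      refine Continuous.aestronglyMeasurable ?_
      have : ∀ θ : ℝ, Complex.exp (Complex.I * θ) ≠ 0 := fun θ => Complex.exp_ne_zero _
      fun_prop (disch := assumption))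
    (fun k => by
      refine Filter.Eventually.of_forall fun θ _ => ?_
      simp [hnorm])
    (Filter.Eventually.of_forall fun θ _ => Real.summable_pow_div_factorial _)
    intervalIntegrable_const
    (Filter.Eventually.of_forall fun θ _ => by
      simp_rw [hterm]
      refine HasSum.mul_left _ ?_
      rw [Complex.exp_eq_exp_ℂ]
      exact NormedSpace.expSeries_div_hasSum_exp _)
  refine hs.unique ?_
  simp_rw [intervalIntegral.integral_const_mul, integral_exp_int_mul]
  have : (fun k : ℕ => c ^ k / (k.factorial : ℂ) * if (p : ℤ) - k = 0 then 2 * (π : ℂ) else 0) =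
      fun k : ℕ => if k = p then 2 * π * (c ^ p / (p.factorial : ℂ)) else 0 := by
    funext k
    by_cases hk : k = p
    · subst hk
      simp
      ring
    · have : (p : ℤ) - k ≠ 0 := by omega
      simp [hk, this]
  rw [this]
  exact hasSum_ite_eq p _

lemma integral_circle_kernel_mul_pow (N m : ℕ) (s ζ : ℂ) (hs : s ^ 2 = N) :
    ∫ θ in (0 : ℝ)..(2 * π), Complex.exp (Complex.I * θ) ^ N *
      Complex.exp (-(s * ζ) * (Complex.exp (Complex.I * θ))⁻¹) *
        (ζ + s * Complex.exp (Complex.I * θ)) ^ m =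
      2 * π * (-s) ^ N * laguerreCoeff N m * ζ ^ (m + N) := by
  have hexp : ∀ θ : ℝ, Complex.exp (Complex.I * θ) ^ N *
      Complex.exp (-(s * ζ) * (Complex.exp (Complex.I * θ))⁻¹) *
        (ζ + s * Complex.exp (Complex.I * θ)) ^ m =
      ∑ j ∈ Finset.range (m + 1), (s ^ j * ζ ^ (m - j) * (m.choose j : ℂ)) *
        (Complex.exp (Complex.I * θ) ^ (N + j) *
          Complex.exp (-(s * ζ) * (Complex.exp (Complex.I * θ))⁻¹)) := by
    intro θ
    rw [add_comm ζ, add_pow, Finset.mul_sum]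
    refine Finset.sum_congr rfl fun j _ => ?_
    rw [mul_pow, pow_add]
    ring
  simp_rw [hexp]
  rw [intervalIntegral.integral_finsetSum]
  · simp_rw [intervalIntegral.integral_const_mul, integral_pow_mul_exp_inv]
    rw [laguerreCoeff, Finset.mul_sum, Finset.sum_mul]
    refine Finset.sum_congr rfl fun j hj => ?_
    have hj' : j ≤ m := Nat.lt_succ_iff.1 (Finset.mem_range.1 hj)
    have hζ : ζ ^ (m + N) = ζ ^ (m - j) * ζ ^ (N + j) := by
      rw [← pow_add]; congr 1; omega
    have h1 : (-(s * ζ)) ^ (N + j) = (-s) ^ N * (-s) ^ j * ζ ^ (N + j) := by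
      rw [← pow_add, ← mul_pow]; ring
    have h2 : (-(N : ℂ)) ^ j = s ^ j * (-s) ^ j := by
      rw [← mul_pow, ← hs]; ring
    rw [hζ, h1, h2]
    ring
  · intro j _
    refine Continuous.intervalIntegrable ?_ _ _
    have : ∀ θ : ℝ, Complex.exp (Complex.I * θ) ≠ 0 := fun θ => Complex.exp_ne_zero _
    fun_prop (disch := assumption)

lemma hasSum_integral_circle_kernel (N : ℕ) (s ζ : ℂ) (hs : s ^ 2 = N) {F : ℂ → ℂ} {a : ℕ → ℂ}
    (hF : ∀ z, HasSum (fun m => a m * z ^ m) (F z)) :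
    HasSum (fun m => a m * (2 * π * (-s) ^ N * laguerreCoeff N m * ζ ^ (m + N)))
      (∫ θ in (0 : ℝ)..(2 * π), Complex.exp (Complex.I * θ) ^ N *
        Complex.exp (-(s * ζ) * (Complex.exp (Complex.I * θ))⁻¹) *
          F (ζ + s * Complex.exp (Complex.I * θ))) := by
  have hnorm : ∀ θ : ℝ, ‖Complex.exp (Complex.I * θ)‖ = 1 := fun θ => by
    rw [mul_comm]; exact Complex.norm_exp_ofReal_mul_I θ
  have hsum : Summable fun m => Real.exp ‖s * ζ‖ * (‖a m‖ * (‖ζ‖ + ‖s‖) ^ m) := by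
    refine Summable.mul_left _ ?_
    have h := (hF ((‖ζ‖ + ‖s‖ : ℝ) : ℂ)).summable.norm
    refine h.congr fun m => ?_
    rw [norm_mul, norm_pow, Complex.norm_real, Real.norm_of_nonneg (by positivity)]
  simp_rw [← integral_circle_kernel_mul_pow N _ s ζ hs, ← intervalIntegral.integral_const_mul]
  refine intervalIntegral.hasSum_integral_of_dominated_convergence
    (fun m _ => Real.exp ‖s * ζ‖ * (‖a m‖ * (‖ζ‖ + ‖s‖) ^ m)) (fun m => ?_) (fun m => ?_)
    (Filter.Eventually.of_forall fun θ _ => hsum) intervalIntegrable_const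
    (Filter.Eventually.of_forall fun θ _ => ?_)
  · refine Continuous.aestronglyMeasurable ?_
    have : ∀ θ : ℝ, Complex.exp (Complex.I * θ) ≠ 0 := fun θ => Complex.exp_ne_zero _
    fun_prop (disch := assumption)
  · refine Filter.Eventually.of_forall fun θ _ => ?_
    have h1 : ‖Complex.exp (-(s * ζ) * (Complex.exp (Complex.I * θ))⁻¹)‖ ≤ Real.exp ‖s * ζ‖ := by
      refine (Complex.norm_exp_le_exp_norm _).trans (Real.exp_le_exp.2 ?_)
      rw [norm_mul, norm_inv, hnorm, norm_neg]
      simp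
    have h2 : ‖ζ + s * Complex.exp (Complex.I * θ)‖ ≤ ‖ζ‖ + ‖s‖ := by
      refine (norm_add_le _ _).trans ?_
      rw [norm_mul, hnorm, mul_one]
    rw [norm_mul, norm_mul, norm_mul, norm_pow, norm_pow, hnorm, one_pow, one_mul]
    calc _ ≤ ‖a m‖ * (Real.exp ‖s * ζ‖ * (‖ζ‖ + ‖s‖) ^ m) := by gcongr
      _ = _ := by ring
  · refine ((hF _).mul_left _).congr_fun ?_
    intro m
    ring

lemma integral_circle_inv (Φ : ℂ → ℂ) :
    ∫ θ in (0 : ℝ)..(2 * π), Φ (Complex.exp (Complex.I * θ))⁻¹ =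
      ∫ θ in (0 : ℝ)..(2 * π), Φ (Complex.exp (Complex.I * θ)) := by
  have h := intervalIntegral.integral_comp_sub_left (a := 0) (b := 2 * π)
    (fun θ : ℝ => Φ (Complex.exp (Complex.I * θ))) (2 * π)
  simp only [sub_self, sub_zero] at h
  rw [← h]
  refine intervalIntegral.integral_congr fun θ _ => ?_
  have : Complex.exp (Complex.I * ((2 * π - θ : ℝ) : ℂ)) = (Complex.exp (Complex.I * θ))⁻¹ := by
    rw [← Complex.exp_neg, ← Complex.exp_periodic (-(Complex.I * θ))]
    push_cast
    ring_nf
  simp only [this]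

lemma betaP_circle (N : ℕ) {w : ℂ} {t : ℝ} (hw : w = Complex.exp (2 * Complex.I * t)) (F : ℂ → ℂ)
    (ζ : ℂ) :
    betaP N w t F ζ = Complex.exp (-(N : ℂ) / 2) * (w ^ N *
      Complex.exp (-((Real.sqrt N : ℝ) * ζ) * w⁻¹) * F (ζ + (Real.sqrt N : ℝ) * w)) := by
  have hn : ‖w‖ = 1 := by
    rw [hw, show 2 * Complex.I * (t : ℂ) = ((2 * t : ℝ) : ℂ) * Complex.I by push_cast; ring]
    exact Complex.norm_exp_ofReal_mul_I _
  have hconj : (starRingEnd ℂ) w = w⁻¹ := by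
    rw [Complex.inv_def, Complex.normSq_eq_norm_sq, hn]; simp
  have hpow : w ^ N = Complex.exp (2 * Complex.I * (N : ℂ) * t) := by
    rw [hw, ← Complex.exp_nat_mul]; ring_nf
  rw [betaP, hconj, Complex.normSq_eq_norm_sq, hn, hpow, ← mul_assoc, ← Complex.exp_add,
    ← Complex.exp_add]
  congr 2
  push_cast
  ring

lemma Jop_one_eq {n : ℤ} (hn : n ≠ 0) (F : ℂ → ℂ) (ζ : ℂ) :
    Jop n 1 F ζ = ((1 / (2 * π) : ℝ) : ℂ) * (Complex.exp (-(n.natAbs : ℂ) / 2) *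
      ∫ θ in (0 : ℝ)..(2 * π), Complex.exp (Complex.I * θ) ^ n.natAbs *
        Complex.exp (-((Real.sqrt n.natAbs : ℝ) * ζ) * (Complex.exp (Complex.I * θ))⁻¹) *
          F (ζ + (Real.sqrt n.natAbs : ℝ) * Complex.exp (Complex.I * θ))) := by
  rw [Jop, ← intervalIntegral.integral_const_mul (Complex.exp _)]
  congr 1
  rcases lt_or_gt_of_ne hn with h | h
  · rw [← integral_circle_inv fun w => Complex.exp (-(n.natAbs : ℂ) / 2) * (w ^ n.natAbs *
      Complex.exp (-((Real.sqrt n.natAbs : ℝ) * ζ) * w⁻¹) *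
        F (ζ + (Real.sqrt n.natAbs : ℝ) * w))]
    refine intervalIntegral.integral_congr fun θ _ => ?_
    have h0 : ¬ (0 : ℝ) < n := by exact_mod_cast h.not_gt
    have habs : |(n : ℝ)| = (n.natAbs : ℝ) := by rw [Nat.cast_natAbs, Int.cast_abs]
    have hc : (starRingEnd ℂ) (((1 : ℝ) : ℂ) * Complex.exp (Complex.I * θ)) =
        (Complex.exp (Complex.I * θ))⁻¹ := by
      rw [Complex.ofReal_one, one_mul, ← Complex.exp_conj, ← Complex.exp_neg]
      simp
    simp only [beta, if_neg h0, habs, hc]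
    refine betaP_circle _ ?_ _ _
    rw [← Complex.exp_neg]
    push_cast
    ring_nf
  · refine intervalIntegral.integral_congr fun θ _ => ?_
    have h0 : (0 : ℝ) < n := by exact_mod_cast h
    have habs : (n : ℝ) = (n.natAbs : ℝ) := by
      rw [Nat.cast_natAbs, Int.cast_abs, abs_of_pos h0]
    simp only [beta, if_pos h0, Complex.ofReal_one, one_mul]
    rw [habs]
    refine betaP_circle _ ?_ _ _
    push_cast
    ring_nf

lemma hasSum_taylor_of_entire {F : ℂ → ℂ} (hF : Differentiable ℂ F) (z : ℂ) :
    HasSum (fun m => (m.factorial : ℂ)⁻¹ * iteratedDeriv m F 0 * z ^ m) (F z) := by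
  have h := Complex.hasSum_taylorSeries_of_entire hF 0 z
  refine h.congr_fun fun m => ?_
  simp only [sub_zero, smul_eq_mul]
  ring

lemma eq_zero_of_hasSum_pow_zero {b : ℕ → ℂ} (h : ∀ z, HasSum (fun m => b m * z ^ m) 0) (m : ℕ) :
    b m = 0 := by
  have hp : HasFPowerSeriesOnBall (fun _ : ℂ => (0 : ℂ)) (FormalMultilinearSeries.ofScalars ℂ b)
      0 1 := by
    refine ⟨?_, one_pos, fun {y} _ => ?_⟩
    · refine FormalMultilinearSeries.le_radius_of_summable_norm (r := 1) _ ?_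
      refine (h 1).summable.norm.congr fun m => ?_
      simp
    · refine (h y).congr_fun fun m => ?_
      simp [mul_comm]
  have h0 := hp.hasFPowerSeriesAt.eq_zero
  rw [← FormalMultilinearSeries.coeff_ofScalars (𝕜 := ℂ) (p := b) (n := m), h0]
  rfl

lemma eq_zero_of_hasSum_pow_add_zero {b : ℕ → ℂ} {N : ℕ}
    (h : ∀ z, HasSum (fun m => b m * z ^ (m + N)) 0) (m : ℕ) : b m = 0 := by
  have := eq_zero_of_hasSum_pow_zero (b := fun k => if k < N then 0 else b (k - N)) (fun z => by
    rw [← hasSum_nat_add_iff' N]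
    have h0 : ∑ i ∈ Finset.range N, (if i < N then 0 else b (i - N)) * z ^ i = 0 :=
      Finset.sum_eq_zero fun i hi => by simp [Finset.mem_range.1 hi]
    rw [h0]
    simpa using h z) (m + N)
  simpa using this

/-- For every odd integer `n`, the operator `𝒥_n : 𝓗 → 𝓗` is injective. -/
theorem Jop_injective_of_odd (n : ℤ) (hn : Odd n) :
    ∀ F G : ℂ → ℂ, InFock F → InFock G →
      (∀ ζ : ℂ, Jop n 1 F ζ = Jop n 1 G ζ) → F = G := by
  intro F G hF hG hJ
  have hn0 : n ≠ 0 := by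
    rintro rfl
    simp at hn
  have hN : Odd n.natAbs := Int.natAbs_odd.2 hn
  have hs : ((Real.sqrt n.natAbs : ℝ) : ℂ) ^ 2 = n.natAbs := by
    rw [← Complex.ofReal_pow, Real.sq_sqrt (Nat.cast_nonneg _), Complex.ofReal_natCast]
  have hs0 : (-((Real.sqrt n.natAbs : ℝ) : ℂ)) ^ n.natAbs ≠ 0 := by
    refine pow_ne_zero _ (neg_ne_zero.2 fun h => hn0 ?_)
    rw [h] at hs
    simpa using hs.symm
  have hπ : (π : ℂ) ≠ 0 := Complex.ofReal_ne_zero.2 Real.pi_ne_zero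
  have hFs := hasSum_taylor_of_entire hF.1
  have hGs := hasSum_taylor_of_entire hG.1
  have hcoeff : ∀ m, (m.factorial : ℂ)⁻¹ * iteratedDeriv m F 0 =
      (m.factorial : ℂ)⁻¹ * iteratedDeriv m G 0 := by
    intro m
    have hzero := eq_zero_of_hasSum_pow_add_zero (N := n.natAbs)
      (b := fun m => ((m.factorial : ℂ)⁻¹ * iteratedDeriv m F 0 -
        (m.factorial : ℂ)⁻¹ * iteratedDeriv m G 0) *
        (2 * π * (-((Real.sqrt n.natAbs : ℝ) : ℂ)) ^ n.natAbs * laguerreCoeff n.natAbs m))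
      (fun ζ => by
        have h := hJ ζ
        rw [Jop_one_eq hn0, Jop_one_eq hn0] at h
        have h' := mul_left_cancel₀ (Complex.exp_ne_zero _) (mul_left_cancel₀
          (Complex.ofReal_ne_zero.2 (by positivity)) h)
        have hd := (hasSum_integral_circle_kernel n.natAbs _ ζ hs hFs).sub
          (hasSum_integral_circle_kernel n.natAbs _ ζ hs hGs)
        rw [h', sub_self] at hd
        refine hd.congr_fun fun m => ?_
        ring) m
    have hne : 2 * (π : ℂ) * (-((Real.sqrt n.natAbs : ℝ) : ℂ)) ^ n.natAbs *
        laguerreCoeff n.natAbs m ≠ 0 :=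
      mul_ne_zero (mul_ne_zero (mul_ne_zero two_ne_zero hπ) hs0) (laguerreCoeff_ne_zero hN m)
    exact sub_eq_zero.1 ((mul_eq_zero.1 hzero).resolve_right hne)
  funext z
  have h := hFs z
  simp_rw [hcoeff] at h
  exact h.unique (hGs z)

end
end

section
/- Laguerre parity lemma: let n be an odd positive integer and define a_j := j! · L_j^{(n)}(n). Then a_0 = a_1 = 1, the recurrence a_{j+1} = (2j+1)·a_j − j(j+n)·a_{j−1} holds, every a_j is an odd integer, and consequently L_j^{(n)}(n) ≠ 0 for every j ∈ ℕ. -/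
noncomputable section

open Complex MeasureTheory Real Set

theorem factorial_mul_lag_self_succ_succ (α : ℝ) (j : ℕ) :
    ((j + 2).factorial : ℝ) * lag α (j + 2) α
      = (2 * ((j : ℝ) + 1) + 1) * (((j + 1).factorial : ℝ) * lag α (j + 1) α)
        - ((j : ℝ) + 1) * (((j : ℝ) + 1) + α) * ((j.factorial : ℝ) * lag α j α) := by
  have hj : (j : ℝ) + 2 ≠ 0 := by positivity
  simp only [lag, Nat.factorial_succ]
  push_cast
  field_simp
  ring

theorem exists_odd_eq_factorial_mul_lag_self {n : ℕ} (hn : Odd n) (j : ℕ) :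
    ∃ m : ℤ, Odd m ∧ (j.factorial : ℝ) * lag (n : ℝ) j (n : ℝ) = (m : ℝ) := by
  induction j using Nat.twoStepInduction with
  | zero => exact ⟨1, odd_one, by simp [lag]⟩
  | one => exact ⟨1, odd_one, by simp [lag]⟩
  | more j ih₀ ih₁ =>
    obtain ⟨a, -, ha⟩ := ih₀
    obtain ⟨b, hb, hb'⟩ := ih₁
    refine ⟨(2 * ((j : ℤ) + 1) + 1) * b - ((j : ℤ) + 1) * (((j : ℤ) + 1) + n) * a, ?_, ?_⟩
    · have hn' : Odd (n : ℤ) := by exact_mod_cast hn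
      have heven : Even (((j : ℤ) + 1) * (((j : ℤ) + 1) + n)) := by
        rcases Int.even_or_odd ((j : ℤ) + 1) with h | h
        · exact h.mul_right _
        · exact (h.add_odd hn').mul_left _
      exact ((odd_two_mul_add_one _).mul hb).sub_even (heven.mul_right a)
    · rw [factorial_mul_lag_self_succ_succ, ha, hb']
      push_cast
      ring

/-- **Laguerre parity lemma.** For odd positive `n` and `a_j := j! L_j^{(n)}(n)`:
`a_0 = a_1 = 1`, the recurrence `a_{j+1} = (2j+1) a_j − j(j+n) a_{j−1}` holds,
every `a_j` is an odd integer, and hence `L_j^{(n)}(n) ≠ 0` for all `j`. -/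
theorem laguerre_parity (n : ℕ) (hodd : Odd n) (hpos : 0 < n) :
    ((0 : ℕ).factorial : ℝ) * lag (n : ℝ) 0 (n : ℝ) = 1 ∧
    ((1 : ℕ).factorial : ℝ) * lag (n : ℝ) 1 (n : ℝ) = 1 ∧
    (∀ j : ℕ,
      (((j + 2 : ℕ).factorial : ℝ)) * lag (n : ℝ) (j + 2) (n : ℝ)
        = (2 * ((j : ℝ) + 1) + 1) * (((j + 1 : ℕ).factorial : ℝ) * lag (n : ℝ) (j + 1) (n : ℝ))
          - ((j : ℝ) + 1) * (((j : ℝ) + 1) + (n : ℝ)) * ((j.factorial : ℝ) * lag (n : ℝ) j (n : ℝ))) ∧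
    (∀ j : ℕ, ∃ m : ℤ, Odd m ∧ (j.factorial : ℝ) * lag (n : ℝ) j (n : ℝ) = (m : ℝ)) ∧
    (∀ j : ℕ, lag (n : ℝ) j (n : ℝ) ≠ 0) := by
  refine ⟨by simp [lag], by simp [lag], factorial_mul_lag_self_succ_succ (n : ℝ),
    exists_odd_eq_factorial_mul_lag_self hodd, fun j hj => ?_⟩
  obtain ⟨m, hm, h⟩ := exists_odd_eq_factorial_mul_lag_self hodd j
  rw [hj, mul_zero] at h
  have hm0 : m = 0 := by exact_mod_cast h.symm
  simp [hm0] at hm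

end
end

section
/- Homogeneity of the taming X-ray transform: for every ε > 0, every continuous compactly supported f : ℍ → ℂ, every λ > 0 and every (z,t) ∈ ℍ, I^ε_λ f(z,t) = λ^{−1} · I^{ελ}_1(δ_{1/λ}^* f)(λz, λ²t). -/
noncomputable section

open Complex MeasureTheory Real Set

/-- Heisenberg group multiplication on ℂ × ℝ. -/
def hmul (p q : ℂ × ℝ) : ℂ × ℝ :=
  (p.1 + q.1, p.2 + q.2 + (p.1.re * q.1.im - p.1.im * q.1.re) / 2)

/-- The model sub-Riemannian geodesic of charge `lam`:
`γ_λ(s) = (R e^{i s / R}, s R / 2)` with `R = 1/λ`. -/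
def geo (lam : ℝ) (s : ℝ) : ℂ × ℝ :=
  (((lam : ℂ))⁻¹ * Complex.exp (Complex.I * ((lam * s : ℝ) : ℂ)), s / (2 * lam))

/-- The sub-Riemannian X-ray transform `I_λ f (z,t) = ∫ f((z,t)·γ_λ(s)) ds`. -/
def xray (lam : ℝ) (f : ℂ × ℝ → ℂ) (p : ℂ × ℝ) : ℂ :=
  ∫ s : ℝ, f (hmul p (geo lam s))

/-- The model `g_ε`-geodesic of charge `lam`:
`γ^ε_λ(s) = (R e^{i s/R}, s (R² + 2ε²)/(2R))` with `R = 1/λ`. -/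
def geoE (eps lam : ℝ) (s : ℝ) : ℂ × ℝ :=
  (((lam : ℂ))⁻¹ * Complex.exp (Complex.I * ((lam * s : ℝ) : ℂ)),
    s * (1 / lam ^ 2 + 2 * eps ^ 2) * lam / 2)

/-- The taming X-ray transform `I^ε_λ f (z,t) = ∫ f((z,t)·γ^ε_λ(s)) ds`. -/
def xrayE (eps lam : ℝ) (f : ℂ × ℝ → ℂ) (p : ℂ × ℝ) : ℂ :=
  ∫ s : ℝ, f (hmul p (geoE eps lam s))

/-- The Heisenberg dilation `δ_{1/λ}` maps the left translate by `δ_λ (z, t)` of the unit charge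
geodesic, run at speed `λ`, to the left translate by `(z, t)` of the geodesic of charge `λ`. -/
lemma dilation_hmul_geoE (eps : ℝ) {lam : ℝ} (hlam : lam ≠ 0) (z : ℂ) (t s : ℝ) :
    (((1 / lam : ℝ) : ℂ) * (hmul ((lam : ℂ) * z, lam ^ 2 * t) (geoE (eps * lam) 1 (lam * s))).1,
      (1 / lam) ^ 2 * (hmul ((lam : ℂ) * z, lam ^ 2 * t) (geoE (eps * lam) 1 (lam * s))).2)
      = hmul (z, t) (geoE eps lam s) := by
  have hlam' : (lam : ℂ) ≠ 0 := Complex.ofReal_ne_zero.mpr hlam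
  ext1
  · simp only [hmul, geoE, one_mul]
    push_cast
    field_simp
  · simp only [hmul, geoE, one_mul, Complex.ofReal_one, inv_one, ← Complex.ofReal_inv,
      Complex.re_ofReal_mul, Complex.im_ofReal_mul]
    field_simp

/-- **Homogeneity of the taming X-ray transform:**
`I^ε_λ f (z,t) = λ⁻¹ I^{ελ}_1(δ_{1/λ}^* f)(λz, λ²t)` for continuous compactly supported `f`. -/
theorem taming_xray_homogeneity (eps : ℝ) (heps : 0 < eps)
    (f : ℂ × ℝ → ℂ) (hc : Continuous f) (hs : HasCompactSupport f)
    (lam : ℝ) (hlam : 0 < lam) (z : ℂ) (t : ℝ) :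
    xrayE eps lam f (z, t)
      = ((lam : ℂ))⁻¹ *
        xrayE (eps * lam) 1 (fun p => f (((1 / lam : ℝ) : ℂ) * p.1, (1 / lam) ^ 2 * p.2))
          (((lam : ℝ) : ℂ) * z, lam ^ 2 * t) := by
  have hscale := Measure.integral_comp_mul_left
    (fun s : ℝ => f (((1 / lam : ℝ) : ℂ) *
        (hmul ((lam : ℂ) * z, lam ^ 2 * t) (geoE (eps * lam) 1 s)).1,
      (1 / lam) ^ 2 * (hmul ((lam : ℂ) * z, lam ^ 2 * t) (geoE (eps * lam) 1 s)).2)) lam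
  simp only [dilation_hmul_geoE eps hlam.ne', abs_of_pos (inv_pos.mpr hlam),
    Complex.real_smul, Complex.ofReal_inv] at hscale
  exact hscale

end
end

section
/- For every ε > 0, λ > 0 and f ∈ L¹(ℍ): (i) I^ε_λ f(z,t) is finite for almost every (z,t), and ∫_{ℂ×[0,π(1/λ²+2ε²))} |I^ε_λ f(z,t)| · λ dz dt ≤ 2π ‖f‖_{L¹(ℍ)}; (ii) if moreover f is continuous with compact support, then I^ε_λ f(z,t) = I^{ε,red}_λ(P^ε_λ f)(z,t) for every (z,t). (Boundedness and factorization of the taming X-ray transform.) -/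
noncomputable section

open Complex MeasureTheory Real Set ENNReal NNReal

theorem lintegral_eq_tsum_setLIntegral_Ioc_add {S : ℝ} (hS : 0 < S) (a : ℝ) (g : ℝ → ℝ≥0∞) :
    ∫⁻ s, g s = ∑' k : ℤ, ∫⁻ s in Ioc a (a + S), g (s + k * S) := by
  rw [← setLIntegral_univ, ← iUnion_Ioc_add_zsmul hS a,
    lintegral_iUnion (fun _ => measurableSet_Ioc) (pairwise_disjoint_Ioc_add_zsmul a S)]
  refine tsum_congr fun k => ?_
  rw [← (measurePreserving_add_right volume ((k : ℝ) * S)).setLIntegral_comp_preimage_emb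
    (MeasurableEquiv.addRight ((k : ℝ) * S)).measurableEmbedding g, preimage_add_const_Ioc]
  congr 3
  · simp
  · simp only [zsmul_eq_mul]
    push_cast
    ring

theorem integral_eq_setIntegral_Ioc_tsum_add {S : ℝ} (hS : 0 < S) (a : ℝ) {g : ℝ → ℂ}
    (hg : Integrable g) :
    ∫ s, g s = ∫ s in Ioc a (a + S), ∑' k : ℤ, g (s + k * S) := by
  rw [integral_tsum]
  · rw [← setIntegral_univ, ← iUnion_Ioc_add_zsmul hS a,
      integral_iUnion (fun _ => measurableSet_Ioc) (pairwise_disjoint_Ioc_add_zsmul a S)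
        hg.integrableOn]
    refine tsum_congr fun k => ?_
    rw [← (measurePreserving_add_right volume ((k : ℝ) * S)).setIntegral_preimage_emb
      (MeasurableEquiv.addRight ((k : ℝ) * S)).measurableEmbedding g, preimage_add_const_Ioc]
    congr 3
    · simp
    · simp only [zsmul_eq_mul]
      push_cast
      ring
  · exact fun k => (hg.comp_add_right _).aestronglyMeasurable.restrict
  · rw [← lintegral_eq_tsum_setLIntegral_Ioc_add hS a (fun s => ‖g s‖ₑ)]
    exact hg.2.ne

theorem hmul_geoE_add (eps : ℝ) {lam : ℝ} (hlam : lam ≠ 0) (p : ℂ × ℝ) (s : ℝ) (k : ℤ) :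
    hmul p (geoE eps lam (s + k * (2 * π / lam))) =
      ((hmul p (geoE eps lam s)).1,
        (hmul p (geoE eps lam s)).2 + k * (π * (1 / lam ^ 2 + 2 * eps ^ 2))) := by
  have h : Complex.exp (Complex.I * ((lam * (s + k * (2 * π / lam)) : ℝ) : ℂ)) =
      Complex.exp (Complex.I * ((lam * s : ℝ) : ℂ)) := by
    rw [Complex.exp_eq_exp_iff_exists_int]
    refine ⟨k, ?_⟩
    have : (lam : ℂ) ≠ 0 := by exact_mod_cast hlam
    push_cast
    field_simp
  simp only [hmul, geoE, h, Prod.mk.injEq, true_and]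
  field_simp
  ring

theorem hmul_vertical_add (p q : ℂ × ℝ) (r : ℝ) :
    hmul (p.1, p.2 + r) q = ((hmul p q).1, (hmul p q).2 + r) := by
  simp only [hmul, Prod.mk.injEq, true_and]
  ring

theorem continuous_geoE (eps lam : ℝ) : Continuous (geoE eps lam) := by
  unfold geoE
  fun_prop

theorem continuous_hmul : Continuous fun x : (ℂ × ℝ) × (ℂ × ℝ) => hmul x.1 x.2 := by
  unfold hmul
  fun_prop

theorem lintegral_hmul_right (q : ℂ × ℝ) {h : ℂ × ℝ → ℝ≥0∞} (hh : Measurable h) :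
    ∫⁻ p, h (hmul p q) = ∫⁻ p, h p := by
  have hm : Measurable fun p => hmul p q :=
    (continuous_hmul.comp (by fun_prop : Continuous fun p : ℂ × ℝ => (p, q))).measurable
  rw [Measure.volume_eq_prod, lintegral_prod (fun p => h (hmul p q)) (hh.comp hm).aemeasurable,
    lintegral_prod _ hh.aemeasurable]
  simp only [hmul]
  rw [← lintegral_add_right_eq_self (fun z => ∫⁻ t, h (z, t)) q.1]
  refine lintegral_congr fun z => ?_
  rw [← lintegral_add_right_eq_self (fun t => h (z + q.1, t))
    (q.2 + (z.re * q.1.im - z.im * q.1.re) / 2)]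
  simp only [add_assoc]

theorem setLIntegral_lintegral_hmul_geoE (eps : ℝ) {lam : ℝ} (hlam : 0 < lam) (a : ℝ)
    {h : ℂ × ℝ → ℝ≥0∞} (hh : Measurable h) :
    ∫⁻ p in (Set.univ : Set ℂ) ×ˢ Ioc a (a + π * (1 / lam ^ 2 + 2 * eps ^ 2)),
        ∫⁻ s, h (hmul p (geoE eps lam s)) =
      ENNReal.ofReal (2 * π / lam) * ∫⁻ p, h p := by
  have hS : 0 < 2 * π / lam := by positivity
  have hT : 0 < π * (1 / lam ^ 2 + 2 * eps ^ 2) := by positivity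
  set S := 2 * π / lam with hSdef
  set T := π * (1 / lam ^ 2 + 2 * eps ^ 2) with hTdef
  have hm : Measurable fun x : (ℂ × ℝ) × ℝ => h (hmul x.1 (geoE eps lam x.2)) :=
    hh.comp (continuous_hmul.comp (continuous_fst.prodMk
      ((continuous_geoE eps lam).comp continuous_snd))).measurable
  have hF : Measurable fun p : ℂ × ℝ => ∫⁻ s in Ioc 0 (0 + S), h (hmul p (geoE eps lam s)) :=
    hm.lintegral_prod_right'
  have hper : ∀ p : ℂ × ℝ, ∫⁻ s, h (hmul p (geoE eps lam s)) =
      ∑' k : ℤ, ∫⁻ s in Ioc 0 (0 + S), h (hmul (p.1, p.2 + k * T) (geoE eps lam s)) := by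
    intro p
    rw [lintegral_eq_tsum_setLIntegral_Ioc_add hS 0]
    simp only [hSdef, hTdef, hmul_geoE_add eps hlam.ne', hmul_vertical_add]
  calc
    _ = ∫⁻ z, ∫⁻ t in Ioc a (a + T), ∫⁻ s, h (hmul (z, t) (geoE eps lam s)) := by
      rw [Measure.volume_eq_prod, ← Measure.prod_restrict, Measure.restrict_univ,
        lintegral_prod _ hm.lintegral_prod_right'.aemeasurable]
    _ = ∫⁻ z, ∫⁻ t, ∫⁻ s in Ioc 0 (0 + S), h (hmul (z, t) (geoE eps lam s)) := by
      refine lintegral_congr fun z => ?_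
      simp only [hper]
      rw [lintegral_tsum, ← lintegral_eq_tsum_setLIntegral_Ioc_add hT a
        (fun t => ∫⁻ s in Ioc 0 (0 + S), h (hmul (z, t) (geoE eps lam s)))]
      exact fun k => (hF.comp (by fun_prop : Measurable fun t : ℝ => (z, t + k * T))).aemeasurable
    _ = ∫⁻ p, ∫⁻ s in Ioc 0 (0 + S), h (hmul p (geoE eps lam s)) := by
      rw [Measure.volume_eq_prod ℂ ℝ, lintegral_prod _ hF.aemeasurable]
    _ = ∫⁻ s in Ioc 0 (0 + S), ∫⁻ p, h (hmul p (geoE eps lam s)) :=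
      lintegral_lintegral_swap hm.aemeasurable
    _ = _ := by
      simp only [lintegral_hmul_right _ hh, zero_add]
      rw [setLIntegral_const, Real.volume_Ioc, sub_zero, mul_comm]

theorem ae_lintegral_hmul_geoE_lt_top (eps : ℝ) {lam : ℝ} (hlam : 0 < lam)
    {h : ℂ × ℝ → ℝ≥0∞} (hh : Measurable h) (hfin : ∫⁻ p, h p ≠ ∞) :
    ∀ᵐ p : ℂ × ℝ, ∫⁻ s, h (hmul p (geoE eps lam s)) < ∞ := by
  have hT : 0 < π * (1 / lam ^ 2 + 2 * eps ^ 2) := by positivity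
  have hm : Measurable fun p : ℂ × ℝ => ∫⁻ s, h (hmul p (geoE eps lam s)) :=
    Measurable.lintegral_prod_right' (f := fun x : (ℂ × ℝ) × ℝ => h (hmul x.1 (geoE eps lam x.2)))
      (hh.comp (continuous_hmul.comp (continuous_fst.prodMk
        ((continuous_geoE eps lam).comp continuous_snd))).measurable)
  have key : ∀ k : ℤ, ∀ᵐ p ∂volume.restrict ((Set.univ : Set ℂ) ×ˢ
      Ioc (0 + k • (π * (1 / lam ^ 2 + 2 * eps ^ 2)))
        (0 + (k + 1) • (π * (1 / lam ^ 2 + 2 * eps ^ 2)))),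
      ∫⁻ s, h (hmul p (geoE eps lam s)) < ∞ := by
    intro k
    refine ae_lt_top hm ?_
    rw [add_zsmul, one_zsmul, ← add_assoc, setLIntegral_lintegral_hmul_geoE eps hlam _ hh]
    exact ENNReal.mul_ne_top ENNReal.ofReal_ne_top hfin
  rw [← ae_restrict_iUnion_iff, ← Set.prod_iUnion, iUnion_Ioc_add_zsmul hT,
    Set.univ_prod_univ, Measure.restrict_univ] at key
  exact key

theorem ae_ae_hmul_geoE (eps : ℝ) {lam : ℝ} (hlam : 0 < lam) {P : ℂ × ℝ → Prop}
    (hP : ∀ᵐ p, P p) : ∀ᵐ p : ℂ × ℝ, ∀ᵐ s : ℝ, P (hmul p (geoE eps lam s)) := by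
  set N := toMeasurable volume {p | ¬ P p} with hN
  have hN0 : volume N = 0 := by rw [hN, measure_toMeasurable]; exact hP
  have hNm : MeasurableSet N := measurableSet_toMeasurable _ _
  have hind : Measurable (N.indicator fun _ : ℂ × ℝ => (∞ : ℝ≥0∞)) :=
    measurable_const.indicator hNm
  filter_upwards [ae_lintegral_hmul_geoE_lt_top eps hlam hind
    (by rw [lintegral_indicator_const hNm, hN0]; simp)] with p hp
  have hm : Measurable fun s : ℝ =>
      N.indicator (fun _ : ℂ × ℝ => (∞ : ℝ≥0∞)) (hmul p (geoE eps lam s)) :=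
    hind.comp (continuous_hmul.comp (continuous_const.prodMk (continuous_geoE eps lam))).measurable
  filter_upwards [ae_lt_top hm hp.ne] with s hs
  by_contra hc
  rw [Set.indicator_of_mem (subset_toMeasurable _ _ hc)] at hs
  exact lt_irrefl _ hs

theorem hasCompactSupport_comp_hmul_geoE {eps lam : ℝ} (hlam : 0 < lam) {f : ℂ × ℝ → ℂ}
    (hf : HasCompactSupport f) (p : ℂ × ℝ) :
    HasCompactSupport fun s : ℝ => f (hmul p (geoE eps lam s)) := by
  obtain ⟨M, hM⟩ := hf.isCompact.isBounded.exists_norm_le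
  set c := (1 / lam ^ 2 + 2 * eps ^ 2) * lam / 2 with hc
  have hc0 : 0 < c := by positivity
  set B := (M + |p.2| + ‖p.1‖ * lam⁻¹) / c with hB
  refine HasCompactSupport.intro (isCompact_Icc (a := -B) (b := B)) fun s hs => ?_
  by_contra hne
  refine hs (abs_le.mp ?_)
  have h1 := (norm_snd_le _).trans (hM _ (subset_tsupport f hne))
  set w := (geoE eps lam s).1 with hw
  have hwn : ‖w‖ = lam⁻¹ := by
    simp only [hw, geoE, norm_mul, norm_inv, Complex.norm_real, Real.norm_eq_abs, abs_of_pos hlam]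
    rw [mul_comm Complex.I, Complex.norm_exp_ofReal_mul_I, mul_one]
  have h2 : (hmul p (geoE eps lam s)).2 = p.2 + c * s + (p.1.re * w.im - p.1.im * w.re) / 2 := by
    simp only [hmul, ← hw, hc]
    simp only [geoE]
    ring
  have h3 : |p.1.re * w.im - p.1.im * w.re| ≤ 2 * (‖p.1‖ * lam⁻¹) := by
    rw [← hwn, two_mul]
    refine (abs_sub _ _).trans ?_
    rw [abs_mul, abs_mul]
    gcongr
    exacts [Complex.abs_re_le_norm _, Complex.abs_im_le_norm _, Complex.abs_im_le_norm _,
      Complex.abs_re_le_norm _]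
  rw [h2, Real.norm_eq_abs, abs_le] at h1
  rw [abs_le] at h3
  rw [hB, le_div_iff₀ hc0, ← abs_of_pos hc0, ← abs_mul, abs_le]
  constructor <;> linarith [neg_abs_le p.2, le_abs_self p.2]

/-- **Boundedness and factorization of the taming X-ray transform.**
(i) For `f ∈ L¹(ℍ)` the integral defining `I^ε_λ f` converges a.e., and
`∫_{ℂ×[0,π(1/λ²+2ε²))} |I^ε_λ f| λ dz dt ≤ 2π ‖f‖₁`;
(ii) if `f` is continuous with compact support then `I^ε_λ f = I^{ε,red}_λ (P^ε_λ f)` pointwise. -/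
theorem taming_xray_bounded_factors (eps : ℝ) (heps : 0 < eps)
    (lam : ℝ) (hlam : 0 < lam)
    (f : ℂ × ℝ → ℂ) (hf : Integrable f) :
    (∀ᵐ p : ℂ × ℝ, Integrable (fun s : ℝ => f (hmul p (geoE eps lam s)))) ∧
    (∫⁻ p in (Set.univ : Set ℂ) ×ˢ Set.Ico (0 : ℝ) (π * (1 / lam ^ 2 + 2 * eps ^ 2)),
        (‖xrayE eps lam f p‖₊ : ℝ≥0∞) * ENNReal.ofReal lam
      ≤ ENNReal.ofReal (2 * π) * ∫⁻ p : ℂ × ℝ, (‖f p‖₊ : ℝ≥0∞)) ∧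
    (Continuous f → HasCompactSupport f → ∀ p : ℂ × ℝ,
      xrayE eps lam f p
        = ∫ s in (0 : ℝ)..(2 * π / lam),
            (fun q : ℂ × ℝ =>
              ∑' k : ℤ, f (q.1, q.2 + (k : ℝ) * (π * (1 / lam ^ 2 + 2 * eps ^ 2))))
              (hmul p (geoE eps lam s))) := by
  set g := hf.aestronglyMeasurable.mk f with hg
  have hgm : StronglyMeasurable g := hf.aestronglyMeasurable.stronglyMeasurable_mk
  have hfg : f =ᵐ[volume] g := hf.aestronglyMeasurable.ae_eq_mk
  have hfgs := ae_ae_hmul_geoE eps hlam hfg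
  have hgn : Measurable fun p => ‖g p‖ₑ := hgm.enorm
  have hcurve : ∀ p : ℂ × ℝ, Continuous fun s => hmul p (geoE eps lam s) := fun p =>
    continuous_hmul.comp (continuous_const.prodMk (continuous_geoE eps lam))
  have hS : 0 < 2 * π / lam := by positivity
  refine ⟨?_, ?_, fun hcont hsupp p => ?_⟩
  · filter_upwards [hfgs, ae_lintegral_hmul_geoE_lt_top eps hlam hgn (hf.congr hfg).2.ne]
      with p hp hfin
    exact Integrable.congr
      ⟨(hgm.comp_measurable (hcurve p).measurable).aestronglyMeasurable, hfin⟩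
      (hp.mono fun s hs => hs.symm)
  · have hset : (Set.univ : Set ℂ) ×ˢ Set.Ico (0 : ℝ) (π * (1 / lam ^ 2 + 2 * eps ^ 2))
        =ᵐ[volume] (Set.univ : Set ℂ) ×ˢ Ioc (0 : ℝ) (0 + π * (1 / lam ^ 2 + 2 * eps ^ 2)) := by
      rw [zero_add]
      exact Measure.set_prod_ae_eq (Filter.EventuallyEq.rfl) Ico_ae_eq_Ioc
    rw [setLIntegral_congr hset, lintegral_mul_const' _ _ ENNReal.ofReal_ne_top]
    calc
      _ ≤ (∫⁻ p in (Set.univ : Set ℂ) ×ˢ Ioc (0 : ℝ) (0 + π * (1 / lam ^ 2 + 2 * eps ^ 2)),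
            ∫⁻ s, ‖g (hmul p (geoE eps lam s))‖ₑ) * ENNReal.ofReal lam := by
        gcongr 1
        refine lintegral_mono_ae (ae_restrict_of_ae ?_)
        filter_upwards [hfgs] with p hp
        rw [xrayE, integral_congr_ae hp]
        exact enorm_integral_le_lintegral_enorm _
      _ = ENNReal.ofReal (2 * π) * ∫⁻ p, ‖g p‖ₑ := by
        rw [setLIntegral_lintegral_hmul_geoE eps hlam 0 hgn, mul_right_comm,
          ← ENNReal.ofReal_mul hS.le, div_mul_cancel₀ _ hlam.ne']
      _ = _ := by
        congr 1
        exact lintegral_congr_ae (hfg.mono fun p hp => by simp only [← hp]; rfl)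
  · have hint : Integrable fun s => f (hmul p (geoE eps lam s)) :=
      (hcont.comp (hcurve p)).integrable_of_hasCompactSupport
        (hasCompactSupport_comp_hmul_geoE hlam hsupp p)
    rw [xrayE, integral_eq_setIntegral_Ioc_tsum_add hS 0 hint, zero_add,
      intervalIntegral.integral_of_le hS.le]
    simp only [hmul_geoE_add eps hlam.ne']

end
end

section
/- Fix ε > 0 and n ∈ ℤ∖{0}. The set of λ > 0 for which the operator 𝒥_n(1/√(1+2ε²λ²)) : 𝓗 → 𝓗 fails to be injective is countable; in particular, 𝒥_n(1/√(1+2ε²λ²)) is injective for almost every λ > 0 (with respect to Lebesgue measure). -/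
noncomputable section

open Complex MeasureTheory Real Set

theorem hasSum_intervalIntegral_mul_powerSeries {a b R : ℝ} {u v g : ℝ → ℂ} {c : ℕ → ℂ}
    (hu : Continuous u) (hv : Continuous v) (hR : ∀ θ, ‖v θ‖ ≤ R)
    (hc : Summable fun m => ‖c m‖ * R ^ m) (hg : ∀ θ, HasSum (fun m => c m * v θ ^ m) (g θ)) :
    HasSum (fun m => c m * ∫ θ in a..b, u θ * v θ ^ m) (∫ θ in a..b, u θ * g θ) := by
  have key : HasSum (fun m => ∫ θ in a..b, u θ * (c m * v θ ^ m)) (∫ θ in a..b, u θ * g θ) := by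
    refine intervalIntegral.hasSum_integral_of_dominated_convergence
      (fun m θ => ‖u θ‖ * (‖c m‖ * R ^ m)) (fun m => ?_) (fun m => ?_) ?_ ?_ ?_
    · exact (by fun_prop : Continuous fun θ => u θ * (c m * v θ ^ m)).aestronglyMeasurable
    · refine .of_forall fun θ _ => ?_
      rw [norm_mul, norm_mul, norm_pow]
      gcongr
      exact hR θ
    · exact .of_forall fun θ _ => hc.mul_left _
    · simp_rw [tsum_mul_left]
      exact (by fun_prop : Continuous fun θ => ‖u θ‖ * ∑' m, ‖c m‖ * R ^ m).intervalIntegrable _ _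
    · exact .of_forall fun θ _ => (hg θ).mul_left _
  convert! key using 2 with m
  rw [← intervalIntegral.integral_const_mul]
  congr 1 with θ
  ring

theorem integral_exp_pow_mul_exp_inv_pow (a b : ℕ) :
    ∫ θ in (0 : ℝ)..(2 * π), Complex.exp (Complex.I * θ) ^ a * (Complex.exp (Complex.I * θ))⁻¹ ^ b
      = if a = b then ((2 * π : ℝ) : ℂ) else 0 := by
  split_ifs with h
  · subst h
    have : ∀ θ : ℝ, Complex.exp (Complex.I * θ) ^ a * (Complex.exp (Complex.I * θ))⁻¹ ^ a = 1 := by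
      intro θ
      rw [← mul_pow, mul_inv_cancel₀ (Complex.exp_ne_zero _), one_pow]
    simp_rw [this]
    simp
  · have hc : ((a : ℂ) - b) * Complex.I ≠ 0 :=
      mul_ne_zero (sub_ne_zero.2 (by exact_mod_cast h)) Complex.I_ne_zero
    have h1 : ∀ θ : ℝ, Complex.exp (Complex.I * θ) ^ a * (Complex.exp (Complex.I * θ))⁻¹ ^ b
        = Complex.exp (((a : ℂ) - b) * Complex.I * θ) := by
      intro θ
      rw [← Complex.exp_neg, ← Complex.exp_nat_mul, ← Complex.exp_nat_mul, ← Complex.exp_add]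
      congr 1
      ring
    simp_rw [h1]
    rw [integral_exp_mul_complex hc]
    have h2 : Complex.exp (((a : ℂ) - b) * Complex.I * ((2 * π : ℝ) : ℂ)) = 1 := by
      rw [Complex.exp_eq_one_iff]
      exact ⟨(a : ℤ) - b, by push_cast; ring⟩
    rw [h2]
    simp

theorem integral_exp_pow_mul_exp_mul_inv (k : ℕ) (x : ℂ) :
    ∫ θ in (0 : ℝ)..(2 * π), Complex.exp (Complex.I * θ) ^ k *
        Complex.exp (x * (Complex.exp (Complex.I * θ))⁻¹)
      = ((2 * π : ℝ) : ℂ) * (x ^ k / (k.factorial : ℂ)) := by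
  have h := hasSum_intervalIntegral_mul_powerSeries (a := 0) (b := 2 * π) (R := 1)
    (u := fun θ : ℝ => Complex.exp (Complex.I * θ) ^ k)
    (v := fun θ : ℝ => (Complex.exp (Complex.I * θ))⁻¹)
    (g := fun θ : ℝ => Complex.exp (x * (Complex.exp (Complex.I * θ))⁻¹))
    (c := fun m => x ^ m / (m.factorial : ℂ))
    (by fun_prop) (by simp_rw [← Complex.exp_neg]; fun_prop)
    (fun θ => by simp [Complex.norm_exp])
    (by simpa using (NormedSpace.expSeries_div_hasSum_exp x).summable.norm)
    (fun θ => by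
      have := NormedSpace.expSeries_div_hasSum_exp (x * (Complex.exp (Complex.I * θ))⁻¹)
      rw [← Complex.exp_eq_exp_ℂ] at this
      convert! this using 2 with m
      rw [mul_pow]; ring)
  simp_rw [integral_exp_pow_mul_exp_inv_pow] at h
  refine h.unique ?_
  convert hasSum_ite_eq k (((2 * π : ℝ) : ℂ) * (x ^ k / (k.factorial : ℂ))) using 2 with m
  by_cases hm : m = k
  · subst hm; simp [mul_comm]
  · simp [hm, Ne.symm hm]

/-- The common form of `𝒥_n(r)` for both signs of `n`, with `N = |n|`, `τ = √N r` and without the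
scalar prefactor. -/
def twistedMean (N : ℕ) (τ : ℝ) (F : ℂ → ℂ) (ζ : ℂ) : ℂ :=
  ∫ θ in (0 : ℝ)..(2 * π),
    (Complex.exp (Complex.I * θ) ^ N * Complex.exp (-(τ * ζ) * (Complex.exp (Complex.I * θ))⁻¹)) *
      F (ζ + τ * Complex.exp (Complex.I * θ))

/-- The Laguerre-type polynomial `∑ⱼ (m choose j) (-X)^j / (N+j)!`, a multiple of `L_m^{(N)}`. -/
def laguerrePoly (N m : ℕ) : Polynomial ℝ :=
  ∑ j ∈ Finset.range (m + 1),
    Polynomial.C ((-1) ^ j * (m.choose j : ℝ) / ((N + j).factorial : ℝ)) * Polynomial.X ^ j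

theorem laguerrePoly_ne_zero (N m : ℕ) : laguerrePoly N m ≠ 0 := by
  intro h
  have := congrArg (Polynomial.eval 0) h
  simp [laguerrePoly, Polynomial.eval_finsetSum, Finset.sum_range_succ', Nat.factorial_ne_zero]
    at this

theorem continuous_twist (N : ℕ) (x : ℂ) : Continuous fun θ : ℝ =>
    Complex.exp (Complex.I * θ) ^ N * Complex.exp (x * (Complex.exp (Complex.I * θ))⁻¹) := by
  simp_rw [← Complex.exp_neg]
  fun_prop

theorem twistedMean_pow (N m : ℕ) (τ : ℝ) (ζ : ℂ) :
    twistedMean N τ (fun w => w ^ m) ζ =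
      ((2 * π : ℝ) : ℂ) * (-τ) ^ N * ((laguerrePoly N m).eval (τ ^ 2) : ℝ) * ζ ^ (m + N) := by
  have h1 : ∀ θ : ℝ, (Complex.exp (Complex.I * θ) ^ N *
        Complex.exp (-(τ * ζ) * (Complex.exp (Complex.I * θ))⁻¹)) *
        (ζ + τ * Complex.exp (Complex.I * θ)) ^ m =
      ∑ j ∈ Finset.range (m + 1), (τ ^ j * ζ ^ (m - j) * (m.choose j : ℂ)) *
        (Complex.exp (Complex.I * θ) ^ (N + j) *
          Complex.exp (-(τ * ζ) * (Complex.exp (Complex.I * θ))⁻¹)) := by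
    intro θ
    rw [add_comm ζ, add_pow, Finset.mul_sum]
    refine Finset.sum_congr rfl fun j _ => ?_
    rw [mul_pow, pow_add]
    ring
  unfold twistedMean
  simp_rw [h1]
  rw [intervalIntegral.integral_finsetSum
    fun j _ => ((continuous_twist _ _).const_mul _).intervalIntegrable _ _]
  simp_rw [intervalIntegral.integral_const_mul, integral_exp_pow_mul_exp_mul_inv]
  rw [laguerrePoly, Polynomial.eval_finsetSum, Complex.ofReal_sum, Finset.mul_sum, Finset.sum_mul]
  refine Finset.sum_congr rfl fun j hj => ?_
  have hjm : m = m - j + j := by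
    have := Finset.mem_range.1 hj
    omega
  have hζ : ζ ^ (m + N) = ζ ^ (m - j) * ζ ^ j * ζ ^ N := by
    rw [← pow_add, ← hjm, pow_add]
  rw [hζ]
  simp only [Polynomial.eval_mul, Polynomial.eval_C, Polynomial.eval_pow, Polynomial.eval_X]
  push_cast
  rw [neg_pow (τ * ζ : ℂ), neg_pow (τ : ℂ), mul_pow, pow_add (-1 : ℂ), pow_add (τ : ℂ),
    pow_add ζ, ← pow_mul]
  ring

theorem entire_eq_zero_of_twistedMean_eq_zero {N : ℕ} {τ : ℝ} (hτ : τ ≠ 0)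
    (hL : ∀ m, (laguerrePoly N m).eval (τ ^ 2) ≠ 0) {H : ℂ → ℂ} (hH : Differentiable ℂ H)
    (h0 : ∀ ζ, twistedMean N τ H ζ = 0) : H = 0 := by
  set c : ℕ → ℂ := fun m => (m.factorial : ℂ)⁻¹ * iteratedDeriv m H 0 with hc
  have hsum : ∀ w, HasSum (fun m => c m * w ^ m) (H w) := by
    intro w
    convert! Complex.hasSum_taylorSeries_of_entire hH 0 w using 2 with m
    simp only [hc, smul_eq_mul, sub_zero]
    ring
  have hexp : ∀ ζ, HasSum (fun m => c m * (((2 * π : ℝ) : ℂ) * (-τ) ^ N *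
      ((laguerrePoly N m).eval (τ ^ 2) : ℝ)) * ζ ^ (m + N)) 0 := by
    intro ζ
    have h := hasSum_intervalIntegral_mul_powerSeries (a := 0) (b := 2 * π) (R := ‖ζ‖ + |τ|)
      (v := fun θ : ℝ => ζ + τ * Complex.exp (Complex.I * θ))
      (g := fun θ : ℝ => H (ζ + τ * Complex.exp (Complex.I * θ))) (c := c)
      (continuous_twist N (-(τ * ζ))) (by fun_prop)
      (fun θ => (norm_add_le _ _).trans (by simp [Complex.norm_exp]))
      (by
        have := (hsum ((‖ζ‖ + |τ| : ℝ) : ℂ)).summable.norm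
        simp_rw [norm_mul, norm_pow, Complex.norm_real, Real.norm_eq_abs] at this
        rwa [abs_of_nonneg (by positivity : 0 ≤ ‖ζ‖ + |τ|)] at this)
      (fun θ => hsum _)
    have h0ζ := h0 ζ
    unfold twistedMean at h0ζ
    rw [h0ζ] at h
    convert! h using 2 with m
    have := twistedMean_pow N m τ ζ
    unfold twistedMean at this
    rw [this]
    ring
  have hcoef : ∀ m, c m = 0 := by
    set b : ℕ → ℂ := fun k => if N ≤ k then c (k - N) * (((2 * π : ℝ) : ℂ) * (-τ) ^ N *
      ((laguerrePoly N (k - N)).eval (τ ^ 2) : ℝ)) else 0 with hb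
    have hps : HasFPowerSeriesAt (0 : ℂ → ℂ) (FormalMultilinearSeries.ofScalars ℂ b) 0 := by
      rw [hasFPowerSeriesAt_iff]
      refine .of_forall fun ζ => ?_
      simp only [FormalMultilinearSeries.coeff_ofScalars, smul_eq_mul, Pi.zero_apply]
      rw [← (add_left_injective N).hasSum_iff]
      · convert! hexp ζ using 2 with m
        simp [hb, mul_comm]
      · intro k hk
        have : ¬ N ≤ k := fun hNk => hk ⟨k - N, Nat.sub_add_cancel hNk⟩
        simp [hb, this]
    intro m
    have hz := congrArg (fun p => FormalMultilinearSeries.coeff p (m + N)) hps.eq_zero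
    simp only [FormalMultilinearSeries.coeff_ofScalars] at hz
    have hz' : b (m + N) = 0 := hz
    simpa [hb, hL m, hτ, Real.pi_ne_zero] using hz'
  ext w
  exact (hsum w).unique (by simp [hcoef])

theorem Jop_eq_twistedMean {n : ℤ} (hn : n ≠ 0) (r : ℝ) (F : ℂ → ℂ) (ζ : ℂ) :
    Jop n r F ζ = ((1 / (2 * π) : ℝ) : ℂ) *
      (Complex.exp (-((n.natAbs : ℂ) / 2 * (r : ℂ) ^ 2)) *
        twistedMean n.natAbs (Real.sqrt n.natAbs * r) F ζ) := by
  unfold Jop twistedMean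
  congr 1
  have hconj : ∀ θ : ℝ, (starRingEnd ℂ) (Complex.exp (Complex.I * θ)) =
      (Complex.exp (Complex.I * θ))⁻¹ := by
    intro θ
    rw [← Complex.exp_conj, ← Complex.exp_neg]
    simp
  have hnorm : ∀ θ : ℝ, Complex.normSq (Complex.exp (Complex.I * θ)) = 1 := by
    intro θ
    rw [Complex.normSq_eq_norm_sq]
    simp [Complex.norm_exp]
  rw [← intervalIntegral.integral_const_mul]
  rcases lt_or_gt_of_ne hn with hneg | hpos
  · have hN : ((n.natAbs : ℕ) : ℝ) = |(n : ℝ)| := by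
      rw [Nat.cast_natAbs]; push_cast; rfl
    have hn' : ¬ (0 : ℝ) < n := by
      have : (n : ℝ) < 0 := by exact_mod_cast hneg
      exact this.not_gt
    have hrefl := intervalIntegral.integral_comp_sub_left (a := 0) (b := 2 * π)
      (fun θ : ℝ => Complex.exp (-((n.natAbs : ℂ) / 2 * (r : ℂ) ^ 2)) *
        ((Complex.exp (Complex.I * θ) ^ n.natAbs * Complex.exp
          (-(((Real.sqrt n.natAbs * r : ℝ) : ℂ) * ζ) * (Complex.exp (Complex.I * θ))⁻¹)) *
        F (ζ + ((Real.sqrt n.natAbs * r : ℝ) : ℂ) * Complex.exp (Complex.I * θ)))) (2 * π)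
    rw [sub_self, sub_zero] at hrefl
    rw [← hrefl]
    refine intervalIntegral.integral_congr fun θ _ => ?_
    have hE : Complex.exp (Complex.I * ((2 * π - θ : ℝ) : ℂ)) =
        (Complex.exp (Complex.I * θ))⁻¹ := by
      rw [← Complex.exp_neg, Complex.exp_eq_exp_iff_exists_int]
      exact ⟨1, by push_cast; ring⟩
    simp only [hE]
    have hNC : ((|(n : ℝ)| : ℝ) : ℂ) = (n.natAbs : ℂ) := by
      rw [← hN, Complex.ofReal_natCast]
    simp only [beta, hn', if_false, betaP, map_mul, Complex.conj_ofReal, hconj, map_inv₀, hnorm,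
      Complex.normSq_ofReal, inv_inv, hNC]
    rw [← hN, ← Complex.exp_neg, ← Complex.exp_nat_mul, ← Complex.exp_add,
      ← mul_assoc (Complex.exp (-((n.natAbs : ℂ) / 2 * (r : ℂ) ^ 2))), ← Complex.exp_add]
    congr 1
    · congr 1
      push_cast
      ring
    · congr 1
      push_cast
      ring
  · have hN : (n : ℝ) = ((n.natAbs : ℕ) : ℝ) := by
      rw [Nat.cast_natAbs, abs_of_pos hpos]
    have hn' : (0 : ℝ) < n.natAbs := by
      rw [← hN]; exact_mod_cast hpos
    refine intervalIntegral.integral_congr fun θ _ => ?_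
    simp only [beta, hN, hn', if_true, betaP, map_mul, Complex.conj_ofReal, hconj, hnorm,
      Complex.normSq_ofReal]
    rw [← Complex.exp_neg, ← Complex.exp_nat_mul, ← Complex.exp_add,
      ← mul_assoc (Complex.exp (-((n.natAbs : ℂ) / 2 * (r : ℂ) ^ 2))), ← Complex.exp_add]
    congr 1
    · congr 1
      push_cast
      ring
    · congr 1
      push_cast
      ring

theorem twistedMean_sub (N : ℕ) (τ : ℝ) {F G : ℂ → ℂ} (hF : Continuous F) (hG : Continuous G)
    (ζ : ℂ) : twistedMean N τ (F - G) ζ = twistedMean N τ F ζ - twistedMean N τ G ζ := by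
  unfold twistedMean
  rw [← intervalIntegral.integral_sub]
  · simp only [Pi.sub_apply, mul_sub]
  · exact ((continuous_twist N _).mul (by fun_prop)).intervalIntegrable _ _
  · exact ((continuous_twist N _).mul (by fun_prop)).intervalIntegrable _ _

theorem Jop_injective_of_eval_laguerrePoly_ne_zero {n : ℤ} (hn : n ≠ 0) {r : ℝ} (hr : r ≠ 0)
    (hL : ∀ m, (laguerrePoly n.natAbs m).eval (n.natAbs * r ^ 2) ≠ 0) {F G : ℂ → ℂ}
    (hF : Differentiable ℂ F) (hG : Differentiable ℂ G)
    (hFG : ∀ ζ, Jop n r F ζ = Jop n r G ζ) : F = G := by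
  have hN : (0 : ℝ) < n.natAbs := by exact_mod_cast Int.natAbs_pos.2 hn
  have hτ : Real.sqrt n.natAbs * r ≠ 0 := mul_ne_zero (Real.sqrt_pos.2 hN).ne' hr
  refine sub_eq_zero.1 (entire_eq_zero_of_twistedMean_eq_zero (N := n.natAbs) hτ (fun m => ?_)
    (hF.sub hG) fun ζ => ?_)
  · rw [mul_pow, Real.sq_sqrt hN.le]
    exact hL m
  · have hζ := hFG ζ
    rw [Jop_eq_twistedMean hn, Jop_eq_twistedMean hn] at hζ
    have hpi : ((1 / (2 * π) : ℝ) : ℂ) ≠ 0 := by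
      exact_mod_cast (by positivity : (1 / (2 * π) : ℝ) ≠ 0)
    rw [twistedMean_sub _ _ hF.continuous hG.continuous, sub_eq_zero]
    exact mul_left_cancel₀ (Complex.exp_ne_zero _) (mul_left_cancel₀ hpi hζ)

/-- For fixed `ε > 0` and `n ∈ ℤ∖{0}`, the set of `λ > 0` for which
`𝒥_n(1/√(1+2ε²λ²))` fails to be injective on `𝓗` is countable; in particular
`𝒥_n(1/√(1+2ε²λ²))` is injective for almost every `λ > 0`. -/
theorem Jop_injective_ae (eps : ℝ) (heps : 0 < eps) (n : ℤ) (hn : n ≠ 0) :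
    Set.Countable {lam : ℝ | 0 < lam ∧
      ¬ (∀ F G : ℂ → ℂ, InFock F → InFock G →
          (∀ ζ : ℂ, Jop n (1 / Real.sqrt (1 + 2 * eps ^ 2 * lam ^ 2)) F ζ
              = Jop n (1 / Real.sqrt (1 + 2 * eps ^ 2 * lam ^ 2)) G ζ) → F = G)} ∧
    ∀ᵐ lam ∂(volume.restrict (Set.Ioi (0 : ℝ))),
      ∀ F G : ℂ → ℂ, InFock F → InFock G →
        (∀ ζ : ℂ, Jop n (1 / Real.sqrt (1 + 2 * eps ^ 2 * lam ^ 2)) F ζ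
            = Jop n (1 / Real.sqrt (1 + 2 * eps ^ 2 * lam ^ 2)) G ζ) → F = G := by
  set bad : Set ℝ := {lam : ℝ | 0 < lam ∧
      ¬ (∀ F G : ℂ → ℂ, InFock F → InFock G →
          (∀ ζ : ℂ, Jop n (1 / Real.sqrt (1 + 2 * eps ^ 2 * lam ^ 2)) F ζ
              = Jop n (1 / Real.sqrt (1 + 2 * eps ^ 2 * lam ^ 2)) G ζ) → F = G)} with hbad
  have hN : (0 : ℝ) < n.natAbs := by exact_mod_cast Int.natAbs_pos.2 hn
  set y : ℝ → ℝ := fun lam => n.natAbs * (1 / Real.sqrt (1 + 2 * eps ^ 2 * lam ^ 2)) ^ 2 with hy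
  have hinj : Set.InjOn y (Set.Ioi 0) := by
    intro a ha b hb hab
    have ha' : (0 : ℝ) < a := ha
    have hb' : (0 : ℝ) < b := hb
    simp only [hy, one_div, inv_pow] at hab
    rw [Real.sq_sqrt (by positivity), Real.sq_sqrt (by positivity)] at hab
    have h1 := inv_injective (mul_left_cancel₀ hN.ne' hab)
    have h2 : a ^ 2 = b ^ 2 := by
      have : 2 * eps ^ 2 ≠ 0 := by positivity
      exact mul_left_cancel₀ this (add_left_cancel h1)
    exact (pow_left_inj₀ ha'.le hb'.le two_ne_zero).1 h2
  have hcount : bad.Countable := by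
    have hroots : ({x | ∃ m, (laguerrePoly n.natAbs m).eval x = 0} : Set ℝ).Countable := by
      rw [Set.ofPred_exists]
      exact Set.countable_iUnion fun m =>
        (Polynomial.finite_setOfPred_isRoot (laguerrePoly_ne_zero n.natAbs m)).countable
    refine Set.MapsTo.countable_of_injOn (f := y) ?_ (hinj.mono fun lam h => h.1) hroots
    rintro lam ⟨hlam, hnot⟩
    by_contra hy0
    refine hnot fun F G hF hG hFG => ?_
    refine Jop_injective_of_eval_laguerrePoly_ne_zero hn ?_ (fun m hm => hy0 ⟨m, hm⟩) hF.1 hG.1 hFG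
    positivity
  refine ⟨hcount, ?_⟩
  rw [ae_restrict_iff' measurableSet_Ioi]
  filter_upwards [hcount.ae_notMem volume] with lam h hlam
  by_contra hnot
  exact h ⟨hlam, hnot⟩

end
end

section
/- The reduced X-ray transform has nontrivial kernel: for g(z,t) := z² e^{−|z|²} e^{4it}, one has ∫₀^{2π} g((z,t)·(e^{iθ}, θ/2)) dθ = 0 for every (z,t) ∈ ℍ, i.e. I^red g = 0, even though g is not identically zero. -/
noncomputable section

open Complex MeasureTheory Real Set

/-- The function `g(z,t) = z² e^{−|z|²} e^{4it}`. -/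
def gker : ℂ × ℝ → ℂ := fun p =>
  p.1 ^ 2 * Complex.exp (-((Complex.normSq p.1 : ℝ) : ℂ)) *
    Complex.exp (4 * Complex.I * ((p.2 : ℝ) : ℂ))

/-- On the unit circle the integrand defining the reduced X-ray transform of `gker` is, up to a
factor depending only on `(z, t)`, a holomorphic function of `w = e^{iθ}` away from `w = 0`. -/
lemma gker_hmul_exp (z : ℂ) (t θ : ℝ) :
    gker (hmul (z, t) (Complex.exp (I * θ), θ / 2)) =
      Complex.exp (-((normSq z : ℝ) : ℂ) - 1 + 4 * I * t) *
        (Complex.exp (I * θ) ^ 2 * (z + Complex.exp (I * θ)) ^ 2 *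
          Complex.exp (-2 * z * Complex.exp (-(I * θ)))) := by
  have hre : (Complex.exp (I * θ)).re = Real.cos θ := by
    rw [mul_comm, Complex.exp_ofReal_mul_I_re]
  have him : (Complex.exp (I * θ)).im = Real.sin θ := by
    rw [mul_comm, Complex.exp_ofReal_mul_I_im]
  have hinv : Complex.exp (-(I * θ)) = Real.cos θ - Real.sin θ * I := by
    rw [show -(I * (θ : ℂ)) = (-(θ : ℂ)) * I by ring, Complex.exp_mul_I]
    simp [sub_eq_add_neg]
  have hsq : Complex.exp (I * θ) ^ 2 = Complex.exp (2 * I * θ) := by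
    rw [← Complex.exp_nat_mul]
    congr 1
    push_cast
    ring
  have hexp : -((normSq (z + Complex.exp (I * θ)) : ℝ) : ℂ) +
      4 * I * ((t + θ / 2 + (z.re * (Complex.exp (I * θ)).im -
        z.im * (Complex.exp (I * θ)).re) / 2 : ℝ) : ℂ) =
      (-((normSq z : ℝ) : ℂ) - 1 + 4 * I * t) +
        (2 * I * θ + -2 * z * Complex.exp (-(I * θ))) := by
    have h1 := Real.sin_sq_add_cos_sq θ
    rw [hinv]
    apply Complex.ext
    · simp [normSq_apply, hre, him, -ofReal_cos, -ofReal_sin]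
      linear_combination -h1
    · simp [normSq_apply, hre, him, -ofReal_cos, -ofReal_sin]
      ring
  simp only [gker, hmul]
  rw [mul_assoc, ← Complex.exp_add, hexp, Complex.exp_add, Complex.exp_add (2 * I * θ), ← hsq]
  ring

lemma hasDerivAt_exp_primitive (z : ℂ) (θ : ℝ) :
    HasDerivAt (fun x : ℝ => -I / 4 * ((Complex.exp (I * x) ^ 4 + 2 * z * Complex.exp (I * x) ^ 3) *
        Complex.exp (-2 * z * Complex.exp (-(I * x)))))
      (Complex.exp (I * θ) ^ 2 * (z + Complex.exp (I * θ)) ^ 2 *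
        Complex.exp (-2 * z * Complex.exp (-(I * θ)))) θ := by
  have hl : HasDerivAt (fun x : ℝ => I * (x : ℂ)) I θ := by
    simpa using (hasDerivAt_id θ).ofReal_comp.const_mul I
  have hF := ((((hl.cexp.pow 4).add ((hl.cexp.pow 3).const_mul (2 * z))).mul
    ((hl.neg.cexp.const_mul (-2 * z)).cexp)).const_mul (-I / 4))
  refine hF.congr_deriv ?_
  have hw : Complex.exp (I * θ) * Complex.exp (-(I * θ)) = 1 := by
    rw [← Complex.exp_add, add_neg_cancel, Complex.exp_zero]
  simp only [Pi.add_apply, Pi.pow_apply, Pi.neg_apply]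
  generalize Complex.exp (-2 * z * Complex.exp (-(I * θ))) = e
  generalize Complex.exp (I * θ) = w at *
  generalize Complex.exp (-(I * θ)) = v at *
  push_cast
  have hI := I_sq
  linear_combination (-(w ^ 4 + 3 / 2 * z * w ^ 3) * e
    - (1 / 2) * z * (w ^ 4 + 2 * z * w ^ 3) * v * e) * hI +
    ((1 / 2) * z * (w ^ 3 + 2 * z * w ^ 2) * e) * hw

/-- **The reduced X-ray transform has nontrivial kernel:**
`I^red gker = 0` even though `gker` is not identically zero. -/
theorem reduced_xray_nontrivial_kernel :
    (∀ z : ℂ, ∀ t : ℝ,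
      ∫ θ in (0 : ℝ)..(2 * π),
        gker (hmul (z, t) (Complex.exp (Complex.I * (θ : ℂ)), θ / 2)) = 0) ∧
    gker ≠ 0 := by
  refine ⟨fun z t => ?_, fun h => ?_⟩
  · simp only [gker_hmul_exp]
    rw [intervalIntegral.integral_const_mul,
      intervalIntegral.integral_eq_sub_of_hasDerivAt (fun x _ => hasDerivAt_exp_primitive z x)
        (Continuous.intervalIntegrable (by fun_prop) _ _)]
    have h1 : Complex.exp (I * ((2 * π : ℝ) : ℂ)) = 1 := by
      rw [mul_comm]
      simp
    simp [Complex.exp_neg, h1, -ofReal_mul]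
  · simpa [gker] using congrFun h (1, 0)

end
end
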